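/- arXiv:1907.01387 — 9 statements merged into one kernel-verified Lean document; each statement's English description precedes it below -/
import Mathlib

section
/- Let u be an admissible attenuation coefficient with center C₃, let T ∈ C(ℝ;ℝ³) and R ∈ C(ℝ;SO(3)), and let 𝒥[T,R](t,x₁,x₂) = ∫_ℝ u(C₃ + R(t)(x − C₃ + T(t))) dx₃ be the attenuation mapping. Then for every t ∈ ℝ and every k ∈ ℝ², the two-dimensional Fourier transform of 𝒥[T,R](t,·) satisfies ℱ₂[𝒥[T,R](t,·)](k) = √(2π) · ℱ₃[u](R(t)Pᵀk) · e^{i⟨R(t)Pᵀk, C₃⟩} · e^{i⟨k, P(T(t) − C₃)⟩}, where ℱ₃[u] is the three-dimensional Fourier transform of u. -/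
open MeasureTheory Matrix

noncomputable section

/-- Orthogonal projection of `ℝ³` onto the `x₁x₂`-plane. -/
def P2 (x : Fin 3 → ℝ) : Fin 2 → ℝ := ![x 0, x 1]

/-- The adjoint `Pᵀ : ℝ² → ℝ³`, `k ↦ (k₁, k₂, 0)`. -/
def PT (k : Fin 2 → ℝ) : Fin 3 → ℝ := ![k 0, k 1, 0]

/-- Membership in SO(3): real 3×3 orthogonal matrices with determinant 1. -/
def SO3 (A : Matrix (Fin 3) (Fin 3) ℝ) : Prop := Aᵀ * A = 1 ∧ A.det = 1

/-- Two-dimensional Fourier transform `ℱ₂[g](k) = (2π)⁻¹ ∫ g(p) e^{-i⟨k,p⟩} dp`. -/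
def F2 (g : (Fin 2 → ℝ) → ℝ) (k : Fin 2 → ℝ) : ℂ :=
  (((Real.sqrt (2 * Real.pi))⁻¹ ^ 2 : ℝ) : ℂ) *
    ∫ p : Fin 2 → ℝ, (g p : ℂ) * Complex.exp (-Complex.I * ((k ⬝ᵥ p : ℝ) : ℂ))

/-- Three-dimensional Fourier transform `ℱ₃[u](k) = (2π)^{-3/2} ∫ u(x) e^{-i⟨k,x⟩} dx`. -/
def F3 (u : (Fin 3 → ℝ) → ℝ) (k : Fin 3 → ℝ) : ℂ :=
  (((Real.sqrt (2 * Real.pi))⁻¹ ^ 3 : ℝ) : ℂ) *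
    ∫ x : Fin 3 → ℝ, (u x : ℂ) * Complex.exp (-Complex.I * ((k ⬝ᵥ x : ℝ) : ℂ))

/-- A rigid motion `x ↦ c + A (x - c + b)` with `A ∈ SO(3)` preserves Lebesgue measure. -/
theorem SO3.measurePreserving_motion {A : Matrix (Fin 3) (Fin 3) ℝ} (hA : SO3 A)
    (b c : Fin 3 → ℝ) :
    MeasurePreserving (fun x : Fin 3 → ℝ => c + A *ᵥ (x - c + b)) := by
  have hlin : MeasurePreserving (fun x : Fin 3 → ℝ => A *ᵥ x) := by
    refine ⟨by fun_prop, ?_⟩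
    have h := Real.map_matrix_volume_pi_eq_smul_volume_pi (M := A) (by simp [hA.2])
    simp only [hA.2, inv_one, abs_one, ENNReal.ofReal_one, one_smul] at h
    exact h
  have h := (measurePreserving_add_left volume c).comp
    (hlin.comp ((measurePreserving_add_right volume b).comp
      (measurePreserving_sub_right volume c)))
  exact h

/-- Rotations preserve the dot product. -/
theorem SO3.mulVec_dotProduct_mulVec {A : Matrix (Fin 3) (Fin 3) ℝ} (hA : SO3 A)
    (v w : Fin 3 → ℝ) : (A *ᵥ v) ⬝ᵥ (A *ᵥ w) = v ⬝ᵥ w := by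
  rw [dotProduct_mulVec, vecMul_mulVec, hA.1, vecMul_one]

theorem PT_dotProduct (k : Fin 2 → ℝ) (x : Fin 3 → ℝ) : PT k ⬝ᵥ x = k ⬝ᵥ P2 x := by
  simp [PT, P2, dotProduct, Fin.sum_univ_succ]

/-- Fubini on `ℝ³`, integrating first along the third coordinate. -/
theorem integral_fin_three_eq_integral_integral {f : (Fin 3 → ℝ) → ℂ} (hf : Integrable f) :
    ∫ x, f x = ∫ p : Fin 2 → ℝ, ∫ s : ℝ, f ![p 0, p 1, s] := by
  have he := (volume_preserving_piFinSuccAbove (fun _ : Fin 3 => ℝ) (Fin.last 2)).symm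
  rw [← he.integral_comp', Measure.volume_eq_prod, integral_prod_symm]
  · refine integral_congr_ae (.of_forall fun p => integral_congr_ae (.of_forall fun s => ?_))
    simp only
    congr 1
    ext i
    fin_cases i <;> simp [MeasurableEquiv.piFinSuccAbove, Fin.insertNthEquiv] <;> rfl
  · exact he.integrable_comp_of_integrable hf

/-- Fourier projection-slice type identity for the attenuation mapping. -/
theorem fourier_slice_attenuation
    (u : (Fin 3 → ℝ) → ℝ) (hu_cont : Continuous u) (hu_nonneg : ∀ x, 0 ≤ u x)
    (hu_supp : IsCompact (tsupport u)) (hu_ne : (Function.support u).Nonempty)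
    (C3 : Fin 3 → ℝ)
    (hC3 : C3 = (∫ x : Fin 3 → ℝ, u x)⁻¹ • ∫ x : Fin 3 → ℝ, u x • x)
    (T : ℝ → Fin 3 → ℝ) (hT : Continuous T)
    (R : ℝ → Matrix (Fin 3) (Fin 3) ℝ) (hR : Continuous R) (hRso : ∀ t, SO3 (R t))
    (J : ℝ → (Fin 2 → ℝ) → ℝ)
    (hJ : ∀ t p, J t p = ∫ x3 : ℝ, u (C3 + R t *ᵥ (![p 0, p 1, x3] - C3 + T t)))
    (t : ℝ) (k : Fin 2 → ℝ) :
    F2 (J t) k =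
      ((Real.sqrt (2 * Real.pi) : ℝ) : ℂ) * F3 u (R t *ᵥ PT k)
        * Complex.exp (Complex.I * (((R t *ᵥ PT k) ⬝ᵥ C3 : ℝ) : ℂ))
        * Complex.exp (Complex.I * ((k ⬝ᵥ P2 (T t - C3) : ℝ) : ℂ)) := by
  set A := R t
  have hA : SO3 A := hRso t
  set v := A *ᵥ PT k
  set φ : (Fin 3 → ℝ) → (Fin 3 → ℝ) := fun x => C3 + A *ᵥ (x - C3 + T t) with hφ
  have hφ_mp : MeasurePreserving φ := hA.measurePreserving_motion (T t) C3
  set g : (Fin 3 → ℝ) → ℂ := fun y => (u y : ℂ) * Complex.exp (-Complex.I * ((v ⬝ᵥ y : ℝ) : ℂ))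
    with hg
  have hg_cont : Continuous g := by
    simp only [hg, dotProduct]
    fun_prop
  have hg_int : Integrable g := by
    refine hg_cont.integrable_of_hasCompactSupport ?_
    have hu : HasCompactSupport fun y => (u y : ℂ) :=
      HasCompactSupport.comp_left (g := Complex.ofReal) hu_supp Complex.ofReal_zero
    exact hu.mul_right
  set c : ℂ := Complex.exp (Complex.I * ((v ⬝ᵥ C3 : ℝ) : ℂ))
    * Complex.exp (Complex.I * ((k ⬝ᵥ P2 (T t - C3) : ℝ) : ℂ)) with hc
  have hphase (x : Fin 3 → ℝ) :
      g (φ x) * c = (u (φ x) : ℂ) * Complex.exp (-Complex.I * ((PT k ⬝ᵥ x : ℝ) : ℂ)) := by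
    simp only [hg, hc, mul_assoc, ← Complex.exp_add]
    congr 2
    have h : v ⬝ᵥ φ x = v ⬝ᵥ C3 + (PT k ⬝ᵥ x + k ⬝ᵥ P2 (T t - C3)) := by
      rw [hφ, dotProduct_add, hA.mulVec_dotProduct_mulVec, ← PT_dotProduct, ← dotProduct_add]
      congr 2
      abel
    rw [h]
    push_cast
    ring
  have hcov : ∫ x, g (φ x) * c = (∫ y, g y) * c := by
    rw [integral_mul_const, ← hφ_mp.map_eq,
      integral_map hφ_mp.aemeasurable hg_cont.aestronglyMeasurable, hφ_mp.map_eq]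
  have hslice : ∫ p : Fin 2 → ℝ, (J t p : ℂ) * Complex.exp (-Complex.I * ((k ⬝ᵥ p : ℝ) : ℂ))
      = (∫ y, g y) * c := by
    have hint : Integrable fun x => g (φ x) * c :=
      (hφ_mp.integrable_comp_of_integrable hg_int).mul_const c
    rw [← hcov, integral_fin_three_eq_integral_integral hint]
    refine integral_congr_ae (.of_forall fun p => ?_)
    simp only [hphase, PT_dotProduct, hJ]
    have hp (s : ℝ) : P2 ![p 0, p 1, s] = p := by
      ext i
      fin_cases i <;> rfl
    simp only [hp]
    rw [integral_mul_const, integral_complex_ofReal]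
  have hconst : (((Real.sqrt (2 * Real.pi))⁻¹ ^ 2 : ℝ) : ℂ)
      = ((Real.sqrt (2 * Real.pi) : ℝ) : ℂ) * (((Real.sqrt (2 * Real.pi))⁻¹ ^ 3 : ℝ) : ℂ) := by
    have h : Real.sqrt (2 * Real.pi) ≠ 0 := by positivity
    rw [← Complex.ofReal_mul]
    congr 1
    field_simp
  rw [F2, F3, hslice, hconst, hc]
  ring

end
end

section
/- Let u be an admissible attenuation coefficient with center C₃, let T ∈ C(ℝ;ℝ³), R ∈ C(ℝ;SO(3)), and let 𝒥[T,R](t,x₁,x₂) = ∫_ℝ u(C₃ + R(t)(x − C₃ + T(t))) dx₃ be the attenuation mapping. For each t let C₂(t) = (∫_{ℝ²} 𝒥[T,R](t,x) dx)⁻¹ ∫_{ℝ²} (x₁,x₂) 𝒥[T,R](t,x) dx be the two-dimensional center of the projection image. Then P(C₃ − T(t)) = C₂(t) for every t ∈ ℝ. -/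
open MeasureTheory Matrix

noncomputable section

/-- Fubini's theorem on `ℝ³`, integrating over the last coordinate first. -/
theorem integral_integral_vecCons_eq {E : Type*} [NormedAddCommGroup E] [NormedSpace ℝ E]
    {g : (Fin 3 → ℝ) → E} (hg : Integrable g) :
    ∫ p : Fin 2 → ℝ, ∫ s : ℝ, g ![p 0, p 1, s] = ∫ x : Fin 3 → ℝ, g x := by
  let e := MeasurableEquiv.piFinSuccAbove (fun _ : Fin 3 => ℝ) 2
  have he : MeasurePreserving e.symm :=
    (volume_preserving_piFinSuccAbove (fun _ : Fin 3 => ℝ) 2).symm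
  have hes : ∀ (s : ℝ) (p : Fin 2 → ℝ), e.symm (s, p) = ![p 0, p 1, s] := by
    intro s p
    change Fin.insertNth (α := fun _ => ℝ) (2 : Fin 3) s p = _
    ext i
    fin_cases i <;> rfl
  have hint : Integrable (g ∘ e.symm) :=
    (he.integrable_comp_emb e.symm.measurableEmbedding).2 hg
  rw [← he.integral_comp e.symm.measurableEmbedding g]
  refine Eq.trans ?_ (integral_prod_symm (g ∘ e.symm) hint).symm
  simp only [Function.comp_apply, hes]

/-- Rigid motions `x ↦ c + A (x - c + d)` preserve Lebesgue measure. -/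
theorem SO3.measurePreserving {A : Matrix (Fin 3) (Fin 3) ℝ} (hA : SO3 A) (c d : Fin 3 → ℝ) :
    MeasurePreserving (fun x : Fin 3 → ℝ => c + A *ᵥ (x - c + d)) := by
  have hrot : MeasurePreserving (fun x : Fin 3 → ℝ => A *ᵥ x) := by
    refine ⟨(Continuous.matrix_mulVec continuous_const continuous_id).measurable, ?_⟩
    have h := Real.map_matrix_volume_pi_eq_smul_volume_pi (M := A) (by simp [hA.2])
    rwa [hA.2, inv_one, abs_one, ENNReal.ofReal_one, one_smul] at h
  have h := (measurePreserving_add_left volume c).comp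
    (hrot.comp (measurePreserving_add_right volume (-c + d)))
  have heq : (fun x : Fin 3 → ℝ => c + A *ᵥ (x - c + d)) =
      (fun x => c + x) ∘ (fun x => A *ᵥ x) ∘ fun x => x + (-c + d) := by
    funext x
    simp only [Function.comp_apply, sub_eq_add_neg, add_assoc]
  rw [heq]
  exact h

/-- The two-dimensional center of the attenuation projection image is the projection of the
translated center of the object: `P(C₃ − T(t)) = C₂(t)`. -/
theorem attenuation_center
    (u : (Fin 3 → ℝ) → ℝ) (hu_cont : Continuous u) (hu_nonneg : ∀ x, 0 ≤ u x)
    (hu_supp : IsCompact (tsupport u)) (hu_ne : (Function.support u).Nonempty)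
    (C3 : Fin 3 → ℝ)
    (hC3 : C3 = (∫ x : Fin 3 → ℝ, u x)⁻¹ • ∫ x : Fin 3 → ℝ, u x • x)
    (T : ℝ → Fin 3 → ℝ) (hT : Continuous T)
    (R : ℝ → Matrix (Fin 3) (Fin 3) ℝ) (hR : Continuous R) (hRso : ∀ t, SO3 (R t))
    (J : ℝ → (Fin 2 → ℝ) → ℝ)
    (hJ : ∀ t p, J t p = ∫ x3 : ℝ, u (C3 + R t *ᵥ (![p 0, p 1, x3] - C3 + T t)))
    (C2 : ℝ → Fin 2 → ℝ)
    (hC2 : ∀ t, C2 t = (∫ p : Fin 2 → ℝ, J t p)⁻¹ • ∫ p : Fin 2 → ℝ, J t p • p)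
    (t : ℝ) :
    P2 (C3 - T t) = C2 t := by
  let L : (Fin 3 → ℝ) →L[ℝ] (Fin 3 → ℝ) := LinearMap.toContinuousLinearMap (R t)ᵀ.mulVecLin
  let Q : (Fin 3 → ℝ) →L[ℝ] (Fin 2 → ℝ) :=
    ContinuousLinearMap.pi ![ContinuousLinearMap.proj 0, ContinuousLinearMap.proj 1]
  have hQ : ∀ x, Q x = P2 x := by
    intro x
    ext i
    fin_cases i <;> rfl
  have hcs : HasCompactSupport u := hu_supp
  have hu_int : Integrable u := hu_cont.integrable_of_hasCompactSupport hcs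
  have hux_int : Integrable (fun x => u x • x) :=
    (hu_cont.smul continuous_id).integrable_of_hasCompactSupport hcs.smul_right
  have hm : 0 < ∫ x, u x := by
    obtain ⟨x, hx⟩ := hu_ne
    exact hu_cont.integral_pos_of_hasCompactSupport_nonneg_nonzero hcs hu_nonneg hx
  have hw_int : Integrable (fun x => u x • (x - C3)) := by
    simp only [smul_sub]
    exact hux_int.sub (hu_int.smul_const C3)
  have hw_zero : ∫ x, u x • (x - C3) = 0 := by
    simp only [smul_sub]
    rw [integral_sub hux_int (hu_int.smul_const C3), integral_smul_const, sub_eq_zero]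
    conv_rhs => rw [hC3]
    rw [smul_inv_smul₀ hm.ne']
  set φ : (Fin 3 → ℝ) → Fin 3 → ℝ := fun x => C3 + R t *ᵥ (x - C3 + T t) with hφ
  have hφm : MeasurePreserving φ := (hRso t).measurePreserving C3 (T t)
  have hcomp : ∀ {E : Type} [NormedAddCommGroup E] [NormedSpace ℝ E] {f : (Fin 3 → ℝ) → E},
      Integrable f → ∫ x, f (φ x) = ∫ x, f x := by
    intro E _ _ f hf
    have h := integral_map (f := f) hφm.measurable.aemeasurable
      (by rw [hφm.map_eq]; exact hf.aestronglyMeasurable)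
    rw [← h, hφm.map_eq]
  have hL : ∀ x, L (u (φ x) • (φ x - C3)) = u (φ x) • (x - (C3 - T t)) := by
    intro x
    have : L (φ x - C3) = x - (C3 - T t) := by
      change (R t)ᵀ *ᵥ (C3 + R t *ᵥ (x - C3 + T t) - C3) = _
      rw [add_sub_cancel_left, Matrix.mulVec_mulVec, (hRso t).1, Matrix.one_mulVec]
      abel
    rw [map_smul, this]
  have hv_int : Integrable (fun x => u (φ x)) := hφm.integrable_comp_of_integrable hu_int
  have hvφ_int : Integrable (fun x => u (φ x) • (φ x - C3)) :=
    hφm.integrable_comp_of_integrable hw_int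
  have hd_int : Integrable (fun x => u (φ x) • (x - (C3 - T t))) := by
    simpa only [hL] using L.integrable_comp hvφ_int
  have hd_zero : ∫ x, u (φ x) • (x - (C3 - T t)) = 0 := by
    simp only [← hL]
    rw [L.integral_comp_comm hvφ_int, hcomp hw_int, hw_zero, map_zero]
  have hvx_int : Integrable (fun x => u (φ x) • x) := by
    refine (hd_int.add (hv_int.smul_const (C3 - T t))).congr (.of_forall fun x => ?_)
    simp [smul_sub]
  have hvx : ∫ x, u (φ x) • x = (∫ x, u x) • (C3 - T t) := by
    simp only [smul_sub _ _ (C3 - T t)] at hd_zero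
    rw [integral_sub hvx_int (hv_int.smul_const _), integral_smul_const, sub_eq_zero] at hd_zero
    rw [hd_zero, hcomp hu_int]
  have hJ0 : ∫ p, J t p = ∫ x, u x := by
    simp only [hJ]
    rw [← hcomp hu_int]
    exact integral_integral_vecCons_eq hv_int
  have hJ1 : ∫ p, J t p • p = (∫ x, u x) • P2 (C3 - T t) := by
    rw [← hQ, ← map_smul, ← hvx, ← Q.integral_comp_comm hvx_int,
      ← integral_integral_vecCons_eq (Q.integrable_comp hvx_int)]
    refine integral_congr_ae (.of_forall fun p => ?_)
    have hp : ∀ s : ℝ, Q ![p 0, p 1, s] = p := by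
      intro s
      ext i
      fin_cases i <;> rfl
    simp only [map_smul, hp]
    rw [integral_smul_const, hJ]
  rw [hC2, hJ0, hJ1, inv_smul_smul₀ hm.ne']

end
end

section
/- Let u be an admissible attenuation coefficient with center C₃, let T ∈ C(ℝ;ℝ³), R ∈ C(ℝ;SO(3)), let 𝒥[T,R](t,x₁,x₂) = ∫_ℝ u(C₃ + R(t)(x − C₃ + T(t))) dx₃, let C₂(t) be the two-dimensional center of 𝒥[T,R](t,·), and define the reduced attenuation map 𝒥̃(t,k) = ℱ₂[𝒥[T,R](t,·)](k) · e^{i⟨k, C₂(t)⟩}. Then 𝒥̃(t,k) = √(2π) · ℱ₃[u](R(t)Pᵀk) · e^{i⟨R(t)Pᵀk, C₃⟩} for all t ∈ ℝ and k ∈ ℝ²; in particular 𝒥̃ does not depend on the translation T. -/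
open MeasureTheory Matrix

noncomputable section

theorem P2_continuous : Continuous P2 := by
  unfold P2
  fun_prop

/-- `P2` as a continuous linear map. -/
def P2L : (Fin 3 → ℝ) →L[ℝ] (Fin 2 → ℝ) :=
  ⟨{ toFun := P2
     map_add' := fun x y => by ext i; fin_cases i <;> simp [P2]
     map_smul' := fun a x => by ext i; fin_cases i <;> simp [P2] }, P2_continuous⟩

theorem P2L_apply (x : Fin 3 → ℝ) : P2L x = P2 x := rfl

theorem dotProduct_P2 (k : Fin 2 → ℝ) (x : Fin 3 → ℝ) : k ⬝ᵥ P2 x = PT k ⬝ᵥ x := by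
  simp [dotProduct, P2, PT, Fin.sum_univ_succ]

/-- A rigid motion `x ↦ c + A (x - c + τ)` preserves Lebesgue measure. -/
theorem measurePreserving_rigid {A : Matrix (Fin 3) (Fin 3) ℝ} (hA : SO3 A) (c τ : Fin 3 → ℝ) :
    MeasurePreserving (fun x : Fin 3 → ℝ => c + A *ᵥ (x - c + τ)) := by
  have hm : MeasurePreserving (Matrix.toLin' A) := by
    refine ⟨(LinearMap.continuous_of_finiteDimensional _).measurable, ?_⟩
    rw [Real.map_matrix_volume_pi_eq_smul_volume_pi (by rw [hA.2]; exact one_ne_zero), hA.2]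
    simp
  have factor : (fun x : Fin 3 → ℝ => c + A *ᵥ (x - c + τ)) =
      (c + ·) ∘ Matrix.toLin' A ∘ (· + (τ - c)) := by
    funext x
    simp only [Function.comp_apply, Matrix.toLin'_apply, sub_add_eq_add_sub, add_sub_assoc]
  rw [factor]
  exact (measurePreserving_add_left volume c).comp
    (hm.comp (measurePreserving_add_right volume (τ - c)))

/-- Pairing the projection image of a rigidly moved `u` with a test function `g` on the plane. -/
theorem integral_projection_smul {E : Type*} [NormedAddCommGroup E] [NormedSpace ℝ E]
    [CompleteSpace E] {u : (Fin 3 → ℝ) → ℝ} (hu : Continuous u) (hs : HasCompactSupport u)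
    {A : Matrix (Fin 3) (Fin 3) ℝ} (hA : SO3 A) (c τ : Fin 3 → ℝ)
    {g : (Fin 2 → ℝ) → E} (hg : Continuous g) :
    ∫ p : Fin 2 → ℝ, (∫ z : ℝ, u (c + A *ᵥ (![p 0, p 1, z] - c + τ))) • g p =
      ∫ y : Fin 3 → ℝ, u y • g (P2 (Aᵀ *ᵥ (y - c) + (c - τ))) := by
  set h : (Fin 3 → ℝ) → E := fun y => u y • g (P2 (Aᵀ *ᵥ (y - c) + (c - τ))) with h_def
  set φ : (Fin 3 → ℝ) → Fin 3 → ℝ := fun x => c + A *ᵥ (x - c + τ) with φ_def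
  have hφ : MeasurePreserving φ := measurePreserving_rigid hA c τ
  have hc : Continuous h := by
    have := P2_continuous
    fun_prop
  have hi : Integrable h := hc.integrable_of_hasCompactSupport hs.smul_right
  have hφc : Continuous φ := by fun_prop
  have inv (x : Fin 3 → ℝ) : Aᵀ *ᵥ (φ x - c) + (c - τ) = x := by
    simp [φ_def, Matrix.mulVec_mulVec, hA.1]
  have hval (x : Fin 3 → ℝ) : h (φ x) = u (φ x) • g (P2 x) := by
    simp only [h_def, inv]
  let e := MeasurableEquiv.piFinSuccAbove (fun _ : Fin 3 => ℝ) 2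
  have he : MeasurePreserving e.symm :=
    (volume_preserving_piFinSuccAbove (fun _ : Fin 3 => ℝ) 2).symm
  have e_symm (z : ℝ) (p : Fin 2 → ℝ) : e.symm (z, p) = ![p 0, p 1, z] := by
    ext i
    fin_cases i <;> rfl
  have hiφ : Integrable (fun x => h (φ x)) := (hφ.integrable_comp hi.aestronglyMeasurable).2 hi
  have hie : Integrable (fun q : ℝ × (Fin 2 → ℝ) => h (φ (e.symm q))) :=
    (he.integrable_comp_emb e.symm.measurableEmbedding).2 hiφ
  have h₁ : ∫ y, h y = ∫ x, h (φ x) := by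
    conv_lhs => rw [← hφ.map_eq]
    exact integral_map hφ.aemeasurable hc.aestronglyMeasurable
  rw [h₁, ← he.integral_comp e.symm.measurableEmbedding, Measure.volume_eq_prod,
    integral_prod_symm _ hie]
  congr 1 with p
  rw [← integral_smul_const]
  congr 1 with z
  rw [hval, e_symm]
  congr 2
  ext i
  fin_cases i <;> rfl

/-- The reduced attenuation map is independent of the translation:
`𝒥̃(t,k) = √(2π) ℱ₃[u](R(t)Pᵀk) e^{i⟨R(t)Pᵀk, C₃⟩}`. -/
theorem reduced_attenuation_map_translation_free
    (u : (Fin 3 → ℝ) → ℝ) (hu_cont : Continuous u) (hu_nonneg : ∀ x, 0 ≤ u x)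
    (hu_supp : IsCompact (tsupport u)) (hu_ne : (Function.support u).Nonempty)
    (C3 : Fin 3 → ℝ)
    (hC3 : C3 = (∫ x : Fin 3 → ℝ, u x)⁻¹ • ∫ x : Fin 3 → ℝ, u x • x)
    (T : ℝ → Fin 3 → ℝ) (hT : Continuous T)
    (R : ℝ → Matrix (Fin 3) (Fin 3) ℝ) (hR : Continuous R) (hRso : ∀ t, SO3 (R t))
    (J : ℝ → (Fin 2 → ℝ) → ℝ)
    (hJ : ∀ t p, J t p = ∫ x3 : ℝ, u (C3 + R t *ᵥ (![p 0, p 1, x3] - C3 + T t)))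
    (C2 : ℝ → Fin 2 → ℝ)
    (hC2 : ∀ t, C2 t = (∫ p : Fin 2 → ℝ, J t p)⁻¹ • ∫ p : Fin 2 → ℝ, J t p • p)
    (Jred : ℝ → (Fin 2 → ℝ) → ℂ)
    (hJred : ∀ t k, Jred t k = F2 (J t) k * Complex.exp (Complex.I * ((k ⬝ᵥ C2 t : ℝ) : ℂ)))
    (t : ℝ) (k : Fin 2 → ℝ) :
    Jred t k =
      ((Real.sqrt (2 * Real.pi) : ℝ) : ℂ) * F3 u (R t *ᵥ PT k)
        * Complex.exp (Complex.I * (((R t *ᵥ PT k) ⬝ᵥ C3 : ℝ) : ℂ)) := by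
  have hs : HasCompactSupport u := hu_supp
  have hui : Integrable u := hu_cont.integrable_of_hasCompactSupport hs
  have hux : Integrable (fun x => u x • x) :=
    (hu_cont.smul continuous_id).integrable_of_hasCompactSupport hs.smul_right
  have hpos : 0 < ∫ x, u x := by
    obtain ⟨x, hx⟩ := hu_ne
    exact hu_cont.integral_pos_of_hasCompactSupport_nonneg_nonzero hs hu_nonneg hx
  have hA := hRso t
  set A := R t
  have pairing {E : Type} [NormedAddCommGroup E] [NormedSpace ℝ E] [CompleteSpace E]
      {g : (Fin 2 → ℝ) → E} (hg : Continuous g) :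
      ∫ p, J t p • g p = ∫ y, u y • g (P2 (Aᵀ *ᵥ (y - C3) + (C3 - T t))) := by
    simp only [hJ]
    exact integral_projection_smul hu_cont hs hA C3 (T t) hg
  have mass : ∫ p, J t p = ∫ y, u y := by
    simpa using pairing (g := fun _ => (1 : ℝ)) continuous_const
  have center : C2 t = P2 (C3 - T t) := by
    let L : (Fin 3 → ℝ) →L[ℝ] (Fin 2 → ℝ) := P2L ∘L (Matrix.toLin' Aᵀ).toContinuousLinearMap
    have hL (y : Fin 3 → ℝ) : u y • P2 (Aᵀ *ᵥ (y - C3) + (C3 - T t)) =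
        L (u y • y) + u y • (P2 (C3 - T t) - L C3) := by
      simp only [L, ← P2L_apply, map_add, Matrix.mulVec_sub, map_sub, map_smul, smul_sub, smul_add,
        ContinuousLinearMap.comp_apply, LinearMap.coe_toContinuousLinearMap', Matrix.toLin'_apply]
      abel
    rw [hC2, mass, pairing continuous_id']
    simp only [hL]
    rw [integral_add (L.integrable_comp hux) (hui.smul_const _), L.integral_comp_comm hux,
      integral_smul_const, smul_add, ← map_smul, ← hC3, inv_smul_smul₀ hpos.ne']
    abel
  have phase (y : Fin 3 → ℝ) : k ⬝ᵥ P2 (Aᵀ *ᵥ (y - C3) + (C3 - T t)) =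
      (A *ᵥ PT k) ⬝ᵥ y - (A *ᵥ PT k) ⬝ᵥ C3 + k ⬝ᵥ C2 t := by
    rw [center, dotProduct_P2, dotProduct_P2, dotProduct_add, Matrix.dotProduct_mulVec,
      Matrix.vecMul_transpose, dotProduct_sub]
  have fourier := pairing
    (g := fun p => Complex.exp (-Complex.I * ((k ⬝ᵥ p : ℝ) : ℂ)))
    (by simp only [dotProduct]; fun_prop)
  simp only [Complex.real_smul, phase] at fourier
  have split (y : Fin 3 → ℝ) : (u y : ℂ) * Complex.exp (-Complex.I *
        (((A *ᵥ PT k) ⬝ᵥ y - (A *ᵥ PT k) ⬝ᵥ C3 + k ⬝ᵥ C2 t : ℝ) : ℂ)) =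
      (u y : ℂ) * Complex.exp (-Complex.I * (((A *ᵥ PT k) ⬝ᵥ y : ℝ) : ℂ)) *
        (Complex.exp (Complex.I * (((A *ᵥ PT k) ⬝ᵥ C3 : ℝ) : ℂ)) *
          Complex.exp (-(Complex.I * ((k ⬝ᵥ C2 t : ℝ) : ℂ)))) := by
    rw [mul_assoc, ← Complex.exp_add, ← Complex.exp_add]
    congr 2
    push_cast
    ring
  simp only [split] at fourier
  rw [integral_mul_const] at fourier
  have hsq : ((Real.sqrt (2 * Real.pi) : ℝ) : ℂ) ≠ 0 := by
    exact_mod_cast (Real.sqrt_pos.2 (by positivity)).ne'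
  rw [hJred, F2, F3, fourier, Complex.exp_neg]
  have hexp := Complex.exp_ne_zero (Complex.I * ((k ⬝ᵥ C2 t : ℝ) : ℂ))
  push_cast
  field_simp

end
end

section
/- Let u be an admissible attenuation coefficient with center C₃, let R ∈ C(ℝ;SO(3)), and let 𝒥̃(t,k) = √(2π) · ℱ₃[u](R(t)Pᵀk) · e^{i⟨R(t)Pᵀk, C₃⟩} be the reduced attenuation map. Then for all λ ∈ ℝ and all s, t ∈ ℝ with s ≠ t, the common-line symmetry 𝒥̃(s, (λ/(t−s)) P(e₃ × (R(s)ᵀR(t)e₃))) = 𝒥̃(t, (λ/(s−t)) P(e₃ × (R(t)ᵀR(s)e₃))) holds, where × denotes the cross product in ℝ³ and e₃ = (0,0,1). -/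
open MeasureTheory Matrix

noncomputable section

/-- The third standard basis vector `e₃ = (0,0,1)` of `ℝ³`. -/
def e3 : Fin 3 → ℝ := ![0, 0, 1]

/-- The cofactor identity `Aᵀ (A v × A w) = det A • (v × w)`. -/
lemma transpose_mulVec_crossProduct_mulVec (A : Matrix (Fin 3) (Fin 3) ℝ) (v w : Fin 3 → ℝ) :
    Aᵀ *ᵥ crossProduct (A *ᵥ v) (A *ᵥ w) = A.det • crossProduct v w := by
  ext i
  fin_cases i <;>
    simp [cross_apply, mulVec, dotProduct, Fin.sum_univ_three, det_fin_three] <;> ring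

/-- Rotations commute with the cross product. -/
lemma SO3.mulVec_crossProduct {A : Matrix (Fin 3) (Fin 3) ℝ} (hA : SO3 A) (v w : Fin 3 → ℝ) :
    A *ᵥ crossProduct v w = crossProduct (A *ᵥ v) (A *ᵥ w) := by
  rw [← one_smul ℝ (crossProduct v w), ← hA.2, ← transpose_mulVec_crossProduct_mulVec,
    mulVec_mulVec, mul_eq_one_comm.mp hA.1, one_mulVec]

lemma PT_smul_P2_crossProduct_e3 (c : ℝ) (v : Fin 3 → ℝ) :
    PT (c • P2 (crossProduct e3 v)) = c • crossProduct e3 v := by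
  ext i
  fin_cases i <;> simp [PT, P2, e3, cross_apply]

lemma SO3.mulVec_PT_smul_P2_crossProduct_e3 {A : Matrix (Fin 3) (Fin 3) ℝ} (hA : SO3 A)
    (B : Matrix (Fin 3) (Fin 3) ℝ) (c : ℝ) :
    A *ᵥ PT (c • P2 (crossProduct e3 ((Aᵀ * B) *ᵥ e3))) =
      c • crossProduct (A *ᵥ e3) (B *ᵥ e3) := by
  rw [PT_smul_P2_crossProduct_e3, mulVec_smul, hA.mulVec_crossProduct, mulVec_mulVec,
    ← Matrix.mul_assoc, mul_eq_one_comm.mp hA.1, Matrix.one_mul]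

/-- Common-line symmetry of the reduced attenuation map. -/
theorem reduced_attenuation_common_line_symmetry
    (u : (Fin 3 → ℝ) → ℝ) (hu_cont : Continuous u) (hu_nonneg : ∀ x, 0 ≤ u x)
    (hu_supp : IsCompact (tsupport u)) (hu_ne : (Function.support u).Nonempty)
    (C3 : Fin 3 → ℝ)
    (hC3 : C3 = (∫ x : Fin 3 → ℝ, u x)⁻¹ • ∫ x : Fin 3 → ℝ, u x • x)
    (R : ℝ → Matrix (Fin 3) (Fin 3) ℝ) (hR : Continuous R) (hRso : ∀ t, SO3 (R t))
    (Jred : ℝ → (Fin 2 → ℝ) → ℂ)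
    (hJred : ∀ t k, Jred t k =
      ((Real.sqrt (2 * Real.pi) : ℝ) : ℂ) * F3 u (R t *ᵥ PT k)
        * Complex.exp (Complex.I * (((R t *ᵥ PT k) ⬝ᵥ C3 : ℝ) : ℂ)))
    (lam : ℝ) (s t : ℝ) (hst : s ≠ t) :
    Jred s ((lam / (t - s)) • P2 (crossProduct e3 (((R s)ᵀ * R t) *ᵥ e3))) =
      Jred t ((lam / (s - t)) • P2 (crossProduct e3 (((R t)ᵀ * R s) *ᵥ e3))) := by
  have h_freq : R s *ᵥ PT ((lam / (t - s)) • P2 (crossProduct e3 (((R s)ᵀ * R t) *ᵥ e3))) =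
      R t *ᵥ PT ((lam / (s - t)) • P2 (crossProduct e3 (((R t)ᵀ * R s) *ᵥ e3))) := by
    rw [(hRso s).mulVec_PT_smul_P2_crossProduct_e3, (hRso t).mulVec_PT_smul_P2_crossProduct_e3,
      ← cross_anticomm, ← neg_sub t s, div_neg, smul_neg, neg_smul]
  rw [hJred, hJred, h_freq]

end
end

section
/- Let u be an admissible attenuation coefficient with center C₃, let R ∈ C²(ℝ;SO(3)) with angular velocity ω ∈ C¹(ℝ;ℝ³) defined by R(t)ᵀR′(t)x = ω(t) × x for all x ∈ ℝ³, written in cylindrical form ω(t) = (α(t)v(t), ω₃(t)) with α(t) ≥ 0 and v(t) ∈ S¹, and let 𝒥̃(t,k) = √(2π) · ℱ₃[u](R(t)Pᵀk) · e^{i⟨R(t)Pᵀk, C₃⟩} be the reduced attenuation map. Then for every t ∈ ℝ with α(t) ≠ 0 and every μ ∈ ℝ, ∂ₜ𝒥̃(t, μv(t)) = ω₃(t) · D¹ₖ𝒥̃(t, μv(t))[μ v⊥(t)], where v⊥(t) = (−v₂(t), v₁(t)) and D¹ₖ𝒥̃(t,κ)[w] denotes the derivative of k ↦ 𝒥̃(t,k)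 at κ applied to w. -/
open MeasureTheory Matrix

noncomputable section

attribute [local instance] Matrix.normedAddCommGroup Matrix.normedSpace

open scoped FourierTransform in
theorem differentiable_F3 {u : (Fin 3 → ℝ) → ℝ} (hu_cont : Continuous u)
    (hu_supp : HasCompactSupport u) : Differentiable ℝ (F3 u) := by
  let B : (Fin 3 → ℝ) →L[ℝ] (Fin 3 → ℝ) →L[ℝ] ℝ :=
    (2 * Real.pi)⁻¹ • (dotProductBilin ℝ ℝ (m := Fin 3) (A := ℝ)).toContinuousBilinearMap
  have hcont : Continuous fun x => (u x : ℂ) := Complex.continuous_ofReal.comp hu_cont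
  have hsupp : HasCompactSupport fun x => (u x : ℂ) :=
    hu_supp.comp_left (g := fun r : ℝ => (r : ℂ)) Complex.ofReal_zero
  have hd := VectorFourier.differentiable_fourierIntegral B.flip
    (hcont.integrable_of_hasCompactSupport hsupp (μ := volume))
    (Continuous.integrable_of_hasCompactSupport (continuous_norm.mul hcont.norm)
      hsupp.norm.mul_left)
  have hF : F3 u = fun k => (((Real.sqrt (2 * Real.pi))⁻¹ ^ 3 : ℝ) : ℂ) *
      VectorFourier.fourierIntegral 𝐞 volume B.flip.toLinearMap₁₂ (fun x => (u x : ℂ)) k := by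
    ext k
    rw [F3, VectorFourier.fourierIntegral]
    congr 2
    ext x
    have hB : B.flip.toLinearMap₁₂ x k = (2 * Real.pi)⁻¹ * (k ⬝ᵥ x) := rfl
    rw [hB, Circle.smul_def, smul_eq_mul, Real.fourierChar_apply, mul_comm]
    congr 2
    have := Real.pi_ne_zero
    push_cast
    field_simp
  exact hF ▸ hd.const_mul _

/-- `PT` as a linear map. -/
def PTLin : (Fin 2 → ℝ) →ₗ[ℝ] Fin 3 → ℝ where
  toFun := PT
  map_add' x y := by ext i; fin_cases i <;> simp [PT]
  map_smul' c x := by ext i; fin_cases i <;> simp [PT]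

/-- First-order common-line relation: `∂ₜ𝒥̃(t, μv(t)) = ω₃(t)·D¹ₖ𝒥̃(t, μv(t))[μv⊥(t)]`. -/
theorem first_order_common_line_relation
    (u : (Fin 3 → ℝ) → ℝ) (hu_cont : Continuous u) (hu_nonneg : ∀ x, 0 ≤ u x)
    (hu_supp : IsCompact (tsupport u)) (hu_ne : (Function.support u).Nonempty)
    (C3 : Fin 3 → ℝ)
    (hC3 : C3 = (∫ x : Fin 3 → ℝ, u x)⁻¹ • ∫ x : Fin 3 → ℝ, u x • x)
    (R : ℝ → Matrix (Fin 3) (Fin 3) ℝ) (hR : ContDiff ℝ 2 R) (hRso : ∀ t, SO3 (R t))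
    (ω : ℝ → Fin 3 → ℝ) (hω : ContDiff ℝ 1 ω)
    (hang : ∀ t x, ((R t)ᵀ * deriv R t) *ᵥ x = crossProduct (ω t) x)
    (α ω3 : ℝ → ℝ) (v : ℝ → Fin 2 → ℝ)
    (hαnn : ∀ t, 0 ≤ α t) (hvS : ∀ t, (v t 0) ^ 2 + (v t 1) ^ 2 = 1)
    (hcyl : ∀ t, ω t = ![α t * v t 0, α t * v t 1, ω3 t])
    (Jred : ℝ → (Fin 2 → ℝ) → ℂ)
    (hJred : ∀ t k, Jred t k =
      ((Real.sqrt (2 * Real.pi) : ℝ) : ℂ) * F3 u (R t *ᵥ PT k)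
        * Complex.exp (Complex.I * (((R t *ᵥ PT k) ⬝ᵥ C3 : ℝ) : ℂ)))
    (t : ℝ) (hαt : α t ≠ 0) (μ : ℝ) :
    deriv (fun τ => Jred τ (μ • v t)) t =
      (ω3 t : ℂ) * fderiv ℝ (Jred t) (μ • v t) (μ • ![-(v t 1), v t 0]) := by
  set G : (Fin 3 → ℝ) → ℂ := fun p => ((Real.sqrt (2 * Real.pi) : ℝ) : ℂ) * F3 u p
    * Complex.exp (Complex.I * ((p ⬝ᵥ C3 : ℝ) : ℂ)) with hG
  have hdot : Differentiable ℝ fun p : Fin 3 → ℝ => p ⬝ᵥ C3 := by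
    unfold dotProduct; fun_prop
  have hGd : Differentiable ℝ G :=
    ((differentiable_F3 hu_cont hu_supp).const_mul _).mul
      (((Complex.ofRealCLM.differentiable.comp hdot).const_mul Complex.I).cexp)
  have hJ : ∀ τ k, Jred τ k = G (R τ *ᵥ PT k) := hJred
  have hRt : HasDerivAt R (deriv R t) t := (hR.differentiable two_ne_zero t).hasDerivAt
  have htime : HasDerivAt (fun τ => R τ *ᵥ PT (μ • v t)) (deriv R t *ᵥ PT (μ • v t)) t := by
    let E : Matrix (Fin 3) (Fin 3) ℝ →L[ℝ] Fin 3 → ℝ :=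
      ((mulVecBilin ℝ ℝ).flip (PT (μ • v t))).toContinuousLinearMap
    exact (E.hasFDerivAt (x := R t)).comp_hasDerivAt t hRt
  have hspace : HasFDerivAt (fun k => R t *ᵥ PT k)
      ((R t).mulVecLin.comp PTLin).toContinuousLinearMap (μ • v t) :=
    ((R t).mulVecLin.comp PTLin).toContinuousLinearMap.hasFDerivAt
  have hRR : R t * (R t)ᵀ = 1 := mul_eq_one_comm.mp (hRso t).1
  have hvel : deriv R t *ᵥ PT (μ • v t) =
      ω3 t • (R t *ᵥ PT (μ • ![-(v t 1), v t 0])) := by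
    have h := congrArg (R t *ᵥ ·) (hang t (PT (μ • v t)))
    simp only [mulVec_mulVec, ← Matrix.mul_assoc, hRR, Matrix.one_mul] at h
    rw [h, ← mulVec_smul, hcyl]
    congr 1
    ext i
    fin_cases i <;> simp [PT, crossProduct]; ring
  have hGp := (hGd (R t *ᵥ PT (μ • v t))).hasFDerivAt
  have hL := (hGp.comp_hasDerivAt t htime).deriv
  have hRs := (hGp.comp (μ • v t) hspace).fderiv
  have hlin : fderiv ℝ G (R t *ᵥ PT (μ • v t)) (deriv R t *ᵥ PT (μ • v t)) =
      (ω3 t : ℂ) * fderiv ℝ G (R t *ᵥ PT (μ • v t)) (R t *ᵥ PT (μ • ![-(v t 1), v t 0])) := by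
    rw [hvel, map_smul, Complex.real_smul]
  rw [funext (hJ t), funext fun τ => hJ τ (μ • v t)]
  refine (hL.trans hlin).trans (congrArg _ ?_)
  exact (DFunLike.congr_fun hRs (μ • ![-(v t 1), v t 0])).symm

end
end

section
/- Let u be an admissible attenuation coefficient with center C₃, let R ∈ C⁴(ℝ;SO(3)) with angular velocity ω ∈ C³(ℝ;ℝ³) having cylindrical decomposition ω = (αv, ω₃), v = (cos φ, sin φ), σ = φ′, and let 𝒥̃(t,k) = √(2π) · ℱ₃[u](R(t)Pᵀk) · e^{i⟨R(t)Pᵀk, C₃⟩}. Then for every t ∈ ℝ with α(t) ≠ 0 and σ(t) ≠ −ω₃(t), and every μ ∈ ℝ: A₀(μ) + A₀₂(μ)·α(t)² + A₁(μ)·μ·α′(t)/α(t) = 0, where (omitting the argument t and writing Dⁱ = Dⁱₖ𝒥̃(t, μv(t)) for the i-th derivative in k): A₀(μ) = ¼ μ(ω₃+σ)[ μ²ω₃(ω₃−σ) D³[v⊥,v⊥,v⊥] + 2μ D²[v⊥, ω₃σv − ω₃′v⊥] + 2 D¹[ω₃²v⊥ + ω₃′v] − μ(3ω₃−σ) ∂ₜD²[v⊥,v⊥]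 + 2 ∂ₜₜD¹[v⊥] ], A₀₂(μ) = ½ μ(ω₃+σ) D¹[v⊥], and A₁(μ) = ½ (ω₃+σ)[ μω₃ D²[v⊥,v⊥] − ω₃ D¹[v] − ∂ₜD¹[v⊥] ], with v⊥ = (−v₂, v₁). -/
open MeasureTheory Matrix

noncomputable section

attribute [local instance] Matrix.normedAddCommGroup Matrix.normedSpace

theorem contDiff_F3 {u : (Fin 3 → ℝ) → ℝ} (hu_cont : Continuous u)
    (hu_supp : HasCompactSupport u) : ContDiff ℝ 3 (F3 u) := by
  let L : (Fin 3 → ℝ) →L[ℝ] (Fin 3 → ℝ) →L[ℝ] ℝ :=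
    ((2 * Real.pi)⁻¹ • LinearMap.toContinuousBilinearMap (dotProductBilin ℝ ℝ))
  have hL : ∀ x k, L.toLinearMap₁₂ x k = (2 * Real.pi)⁻¹ * (x ⬝ᵥ k) := fun x k => rfl
  have hint : ∀ n : ℕ, (n : ℕ∞) ≤ 3 →
      Integrable (fun x : Fin 3 → ℝ => ‖x‖ ^ n * ‖(u x : ℂ)‖) volume := by
    intro n _
    refine Continuous.integrable_of_hasCompactSupport (by fun_prop) ?_
    refine hu_supp.mono fun x hx => ?_
    simp only [Function.mem_support] at hx ⊢
    intro h
    simp [h] at hx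
  have h := VectorFourier.contDiff_fourierIntegral (μ := volume) (N := 3) L hint
  have heq : F3 u = fun k => (((Real.sqrt (2 * Real.pi))⁻¹ ^ 3 : ℝ) : ℂ) *
      VectorFourier.fourierIntegral Real.fourierChar volume L.toLinearMap₁₂
        (fun x => (u x : ℂ)) k := by
    funext k
    unfold F3 VectorFourier.fourierIntegral
    congr 1
    refine integral_congr_ae (Filter.Eventually.of_forall fun x => ?_)
    simp only [hL, Circle.smul_def,
      Real.fourierChar_apply, smul_eq_mul]
    rw [mul_comm]
    congr 2
    rw [dotProduct_comm x k]
    push_cast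
    field_simp
  rw [heq]
  exact contDiff_const.mul h

theorem hasDerivAt_mulVec {A : ℝ → Matrix (Fin 3) (Fin 3) ℝ} {A' : Matrix (Fin 3) (Fin 3) ℝ}
    {x : ℝ → Fin 3 → ℝ} {x' : Fin 3 → ℝ} {t : ℝ}
    (hA : HasDerivAt A A' t) (hx : HasDerivAt x x' t) :
    HasDerivAt (fun τ => A τ *ᵥ x τ) (A' *ᵥ x t + A t *ᵥ x') t := by
  have hA' : ∀ i j, HasDerivAt (fun τ => A τ i j) (A' i j) t := fun i =>
    hasDerivAt_pi.1 (hasDerivAt_pi.1 hA i)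
  rw [hasDerivAt_pi] at hx ⊢
  intro i
  have h := HasDerivAt.fun_sum (u := Finset.univ) fun j _ => (hA' i j).mul (hx j)
  simpa only [mulVec, dotProduct, Pi.add_apply, Finset.sum_add_distrib] using! h

theorem hasDerivAt_rotation_mulVec {R : ℝ → Matrix (Fin 3) (Fin 3) ℝ} {ω : ℝ → Fin 3 → ℝ}
    (hR : Differentiable ℝ R) (hRso : ∀ t, SO3 (R t))
    (hang : ∀ t x, ((R t)ᵀ * deriv R t) *ᵥ x = crossProduct (ω t) x)
    {x : ℝ → Fin 3 → ℝ} {x' : Fin 3 → ℝ} {t : ℝ} (hx : HasDerivAt x x' t) :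
    HasDerivAt (fun τ => R τ *ᵥ x τ) (R t *ᵥ (crossProduct (ω t) (x t) + x')) t := by
  have h := hasDerivAt_mulVec (hR t).hasDerivAt hx
  rw [mulVec_add, ← hang, mulVec_mulVec, ← Matrix.mul_assoc,
    mul_eq_one_comm.1 (hRso t).1, Matrix.one_mul]
  exact h

theorem hasDerivAt_crossProduct {a b : ℝ → Fin 3 → ℝ} {a' b' : Fin 3 → ℝ} {t : ℝ}
    (ha : HasDerivAt a a' t) (hb : HasDerivAt b b' t) :
    HasDerivAt (fun τ => crossProduct (a τ) (b τ))
      (crossProduct a' (b t) + crossProduct (a t) b') t := by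
  rw [hasDerivAt_pi] at ha hb ⊢
  intro i
  fin_cases i
  · convert! ((ha 1).mul (hb 2)).sub ((ha 2).mul (hb 1)) using 1
    simp [cross_apply]; ring
  · convert! ((ha 2).mul (hb 0)).sub ((ha 0).mul (hb 2)) using 1
    simp [cross_apply]; ring
  · convert! ((ha 0).mul (hb 1)).sub ((ha 1).mul (hb 0)) using 1
    simp [cross_apply]; ring

theorem iteratedFDeriv_three_apply {E F : Type*} [NormedAddCommGroup E] [NormedSpace ℝ E]
    [NormedAddCommGroup F] [NormedSpace ℝ F] (f : E → F) (x a b c : E) :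
    iteratedFDeriv ℝ 3 f x ![a, b, c] = fderiv ℝ (fderiv ℝ (fderiv ℝ f)) x a b c := by
  rw [iteratedFDeriv_succ_apply_right]
  rw [iteratedFDeriv_two_apply]
  rfl

/-- The linear map `k ↦ A Pᵀ k`. -/
def slice (A : Matrix (Fin 3) (Fin 3) ℝ) : (Fin 2 → ℝ) →L[ℝ] (Fin 3 → ℝ) :=
  LinearMap.toContinuousLinearMap
    { toFun := fun k => A *ᵥ PT k
      map_add' := fun x y => by
        rw [← mulVec_add]; congr 1; ext i; fin_cases i <;> simp [PT]
      map_smul' := fun r x => by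
        rw [RingHom.id_apply, ← mulVec_smul]; congr 1; ext i; fin_cases i <;> simp [PT] }

theorem slice_apply (A : Matrix (Fin 3) (Fin 3) ℝ) (k : Fin 2 → ℝ) :
    slice A k = A *ᵥ PT k := rfl

theorem exists_contDiff_reduced {u : (Fin 3 → ℝ) → ℝ} (hu_cont : Continuous u)
    (hu_supp : HasCompactSupport u) (C3 : Fin 3 → ℝ)
    {R : ℝ → Matrix (Fin 3) (Fin 3) ℝ} {Jred : ℝ → (Fin 2 → ℝ) → ℂ}
    (hJred : ∀ t k, Jred t k =
      ((Real.sqrt (2 * Real.pi) : ℝ) : ℂ) * F3 u (R t *ᵥ PT k)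
        * Complex.exp (Complex.I * (((R t *ᵥ PT k) ⬝ᵥ C3 : ℝ) : ℂ))) :
    ∃ G : (Fin 3 → ℝ) → ℂ, ContDiff ℝ 3 G ∧ ∀ t, Jred t = G ∘ slice (R t) := by
  refine ⟨fun y => ((Real.sqrt (2 * Real.pi) : ℝ) : ℂ) * F3 u y
        * Complex.exp (Complex.I * ((y ⬝ᵥ C3 : ℝ) : ℂ)), ?_, fun t => funext fun k => hJred t k⟩
  have hdot : ContDiff ℝ 3 fun y : Fin 3 → ℝ => y ⬝ᵥ C3 :=
    ContDiff.sum fun i _ => (contDiff_apply ℝ ℝ i).mul contDiff_const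
  exact (contDiff_const.mul (contDiff_F3 hu_cont hu_supp)).mul (contDiff_const.mul
    (Complex.ofRealCLM.contDiff.comp hdot)).cexp




theorem fderiv_comp_slice {G : (Fin 3 → ℝ) → ℂ} (hG : ContDiff ℝ 3 G)
    (A : Matrix (Fin 3) (Fin 3) ℝ) (k a : Fin 2 → ℝ) :
    fderiv ℝ (G ∘ slice A) k a = fderiv ℝ G (A *ᵥ PT k) (A *ᵥ PT a) := by
  rw [fderiv_comp _ (hG.differentiable (by simp) _) (slice A).differentiableAt,
    ContinuousLinearMap.fderiv]
  rfl

theorem iteratedFDeriv_two_comp_slice {G : (Fin 3 → ℝ) → ℂ} (hG : ContDiff ℝ 3 G)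
    (A : Matrix (Fin 3) (Fin 3) ℝ) (k a b : Fin 2 → ℝ) :
    iteratedFDeriv ℝ 2 (G ∘ slice A) k ![a, b] =
      fderiv ℝ (fderiv ℝ G) (A *ᵥ PT k) (A *ᵥ PT a) (A *ᵥ PT b) := by
  rw [(slice A).iteratedFDeriv_comp_right hG k (by norm_num),
    ContinuousMultilinearMap.compContinuousLinearMap_apply, iteratedFDeriv_two_apply]
  rfl

theorem iteratedFDeriv_three_comp_slice {G : (Fin 3 → ℝ) → ℂ} (hG : ContDiff ℝ 3 G)
    (A : Matrix (Fin 3) (Fin 3) ℝ) (k a b c : Fin 2 → ℝ) :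
    iteratedFDeriv ℝ 3 (G ∘ slice A) k ![a, b, c] =
      fderiv ℝ (fderiv ℝ (fderiv ℝ G)) (A *ᵥ PT k) (A *ᵥ PT a) (A *ᵥ PT b) (A *ᵥ PT c) := by
  rw [(slice A).iteratedFDeriv_comp_right hG k (by norm_num),
    ContinuousMultilinearMap.compContinuousLinearMap_apply, ← iteratedFDeriv_three_apply]
  congr 1
  funext i
  fin_cases i <;> rfl

theorem hasDerivAt_angularVelocity {ω : ℝ → Fin 3 → ℝ} {α φ ω3 : ℝ → ℝ}
    (hα : Differentiable ℝ α) (hφ : Differentiable ℝ φ) (hω3 : Differentiable ℝ ω3)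
    (hcyl : ∀ t, ω t = ![α t * Real.cos (φ t), α t * Real.sin (φ t), ω3 t]) (t : ℝ) :
    HasDerivAt ω (deriv α t • ![Real.cos (φ t), Real.sin (φ t), 0]
      + (α t * deriv φ t) • ![-Real.sin (φ t), Real.cos (φ t), 0]
      + deriv ω3 t • ![0, 0, 1]) t := by
  rw [funext hcyl, hasDerivAt_pi]
  have hφt := (hφ t).hasDerivAt
  intro i
  fin_cases i
  · convert! (hα t).hasDerivAt.mul hφt.cos using 1
    simp; ring
  · convert! (hα t).hasDerivAt.mul hφt.sin using 1
    simp; ring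
  · convert! (hω3 t).hasDerivAt using 1
    simp

theorem crossProduct_cylindrical_frame {c s : ℝ} (hcs : c ^ 2 + s ^ 2 = 1) (x y z : ℝ) :
    crossProduct (x • ![c, s, 0] + y • ![-s, c, 0] + z • ![0, 0, 1]) ![c, s, 0]
        = z • ![-s, c, 0] - y • ![0, 0, 1] ∧
      crossProduct (x • ![c, s, 0] + y • ![-s, c, 0] + z • ![0, 0, 1]) ![-s, c, 0]
        = x • ![0, 0, 1] - z • ![c, s, 0] ∧
      crossProduct (x • ![c, s, 0] + y • ![-s, c, 0] + z • ![0, 0, 1]) ![0, 0, 1]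
        = y • ![c, s, 0] - x • ![-s, c, 0] := by
  refine ⟨?_, ?_, ?_⟩ <;> ext i <;> fin_cases i <;> simp [cross_apply] <;>
    first | ring1 | linear_combination (-y) * hcs | linear_combination x * hcs

/-- Third-order common-line relation: `A₀(μ) + A₀₂(μ)α(t)² + A₁(μ)μα′(t)/α(t) = 0`. -/
theorem third_order_common_line_relation
    (u : (Fin 3 → ℝ) → ℝ) (hu_cont : Continuous u) (hu_nonneg : ∀ x, 0 ≤ u x)
    (hu_supp : IsCompact (tsupport u)) (hu_ne : (Function.support u).Nonempty)
    (C3 : Fin 3 → ℝ)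
    (hC3 : C3 = (∫ x : Fin 3 → ℝ, u x)⁻¹ • ∫ x : Fin 3 → ℝ, u x • x)
    (R : ℝ → Matrix (Fin 3) (Fin 3) ℝ) (hR : ContDiff ℝ 4 R) (hRso : ∀ t, SO3 (R t))
    (ω : ℝ → Fin 3 → ℝ) (hω : ContDiff ℝ 3 ω)
    (hang : ∀ t x, ((R t)ᵀ * deriv R t) *ᵥ x = crossProduct (ω t) x)
    (α φ ω3 : ℝ → ℝ)
    (hα : ContDiff ℝ 3 α) (hφ : ContDiff ℝ 3 φ) (hω3 : ContDiff ℝ 3 ω3)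
    (hαnn : ∀ t, 0 ≤ α t)
    (hcyl : ∀ t, ω t = ![α t * Real.cos (φ t), α t * Real.sin (φ t), ω3 t])
    (Jred : ℝ → (Fin 2 → ℝ) → ℂ)
    (hJred : ∀ t k, Jred t k =
      ((Real.sqrt (2 * Real.pi) : ℝ) : ℂ) * F3 u (R t *ᵥ PT k)
        * Complex.exp (Complex.I * (((R t *ᵥ PT k) ⬝ᵥ C3 : ℝ) : ℂ)))
    (t : ℝ) (hαt : α t ≠ 0) (hσ : deriv φ t ≠ -(ω3 t))
    (v vp : Fin 2 → ℝ)
    (hv : v = ![Real.cos (φ t), Real.sin (φ t)])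
    (hvp : vp = ![-Real.sin (φ t), Real.cos (φ t)])
    (μ : ℝ) :
    -- A₀(μ)
    ((μ * (ω3 t + deriv φ t) / 4 : ℝ) : ℂ) *
        (((μ ^ 2 * ω3 t * (ω3 t - deriv φ t) : ℝ) : ℂ) *
            iteratedFDeriv ℝ 3 (Jred t) (μ • v) ![vp, vp, vp]
          + ((2 * μ : ℝ) : ℂ) *
            iteratedFDeriv ℝ 2 (Jred t) (μ • v) ![vp, (ω3 t * deriv φ t) • v - deriv ω3 t • vp]
          + 2 * fderiv ℝ (Jred t) (μ • v) ((ω3 t ^ 2) • vp + deriv ω3 t • v)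
          - ((μ * (3 * ω3 t - deriv φ t) : ℝ) : ℂ) *
            deriv (fun τ => iteratedFDeriv ℝ 2 (Jred τ) (μ • v) ![vp, vp]) t
          + 2 * iteratedDeriv 2 (fun τ => fderiv ℝ (Jred τ) (μ • v) vp) t)
      -- + A₀₂(μ) α(t)²
      + ((μ * (ω3 t + deriv φ t) / 2 : ℝ) : ℂ) * fderiv ℝ (Jred t) (μ • v) vp
          * ((α t ^ 2 : ℝ) : ℂ)
      -- + A₁(μ) μ α′(t)/α(t)
      + (((ω3 t + deriv φ t) / 2 : ℝ) : ℂ) *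
          (((μ * ω3 t : ℝ) : ℂ) * iteratedFDeriv ℝ 2 (Jred t) (μ • v) ![vp, vp]
            - (ω3 t : ℂ) * fderiv ℝ (Jred t) (μ • v) v
            - deriv (fun τ => fderiv ℝ (Jred τ) (μ • v) vp) t)
          * ((μ * (deriv α t / α t) : ℝ) : ℂ)
      = 0 := by
  obtain ⟨G, hG, hJ⟩ := exists_contDiff_reduced hu_cont hu_supp C3 hJred
  have hrot {x : ℝ → Fin 3 → ℝ} {x' : Fin 3 → ℝ} {τ : ℝ} (hx : HasDerivAt x x' τ) :=
    hasDerivAt_rotation_mulVec (hR.differentiable (by norm_num)) hRso hang hx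
  have hrot₁ (X : Fin 3 → ℝ) (τ : ℝ) :
      HasDerivAt (fun τ => R τ *ᵥ X) (R τ *ᵥ crossProduct (ω τ) X) τ := by
    simpa using hrot (hasDerivAt_const τ X)
  obtain ⟨ω', hω'_eq, hω'⟩ : ∃ w, _ = w ∧ HasDerivAt ω w t := ⟨_, rfl, hasDerivAt_angularVelocity (hα.differentiable (by norm_num))
    (hφ.differentiable (by norm_num)) (hω3.differentiable (by norm_num)) hcyl t⟩
  have hrot₂ (X : Fin 3 → ℝ) := hrot (hasDerivAt_crossProduct hω' (hasDerivAt_const t X))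
  have hG₁ : ContDiff ℝ 2 (fderiv ℝ G) := hG.fderiv_right (by norm_num)
  have hG₂ : ContDiff ℝ 1 (fderiv ℝ (fderiv ℝ G)) := hG₁.fderiv_right (by norm_num)
  have hd₁ (X : Fin 3 → ℝ) (τ : ℝ) := ((hG₁.differentiable (by norm_num)
    (R τ *ᵥ X)).hasFDerivAt).comp_hasDerivAt τ (hrot₁ X τ)
  have hd₂ (X : Fin 3 → ℝ) (τ : ℝ) := ((hG₂.differentiable (by norm_num)
    (R τ *ᵥ X)).hasFDerivAt).comp_hasDerivAt τ (hrot₁ X τ)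
  have hD₁ (X Y : Fin 3 → ℝ) := funext fun τ => ((hd₁ X τ).clm_apply (hrot₁ Y τ)).deriv
  have hD₂ (X Y : Fin 3 → ℝ) := (((hd₂ X t).clm_apply (hrot₁ Y t)).clm_apply (hrot₁ Y t)).deriv
  have hD₁₁ (X Y : Fin 3 → ℝ) := ((((hd₂ X t).clm_apply (hrot₂ X)).clm_apply (hrot₁ Y t)).fun_add
    ((hd₁ X t).clm_apply (hrot₂ Y))).deriv
  have hsymm (y a b : Fin 3 → ℝ) :
      fderiv ℝ (fderiv ℝ G) y a b = fderiv ℝ (fderiv ℝ G) y b a :=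
    (hG.contDiffAt.isSymmSndFDerivAt
        (by rw [minSmoothness_of_isRCLikeNormedField]; norm_num)) a b
  simp only [Function.comp_apply] at hD₁ hD₂ hD₁₁
  simp only [hJ, fderiv_comp_slice hG, iteratedFDeriv_two_comp_slice hG,
    iteratedFDeriv_three_comp_slice hG, iteratedDeriv_succ, iteratedDeriv_zero, hD₁, hD₂, hD₁₁]
  have hωt : ω t = α t • ![Real.cos (φ t), Real.sin (φ t), 0]
      + (0 : ℝ) • ![-Real.sin (φ t), Real.cos (φ t), 0] + ω3 t • ![0, 0, 1] := by
    rw [hcyl]; ext i; fin_cases i <;> simp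
  have hframe := crossProduct_cylindrical_frame (Real.cos_sq_add_sin_sq (φ t))
  have hPT (x y : ℝ) : PT (x • v + y • vp) = x • ![Real.cos (φ t), Real.sin (φ t), 0]
      + y • ![-Real.sin (φ t), Real.cos (φ t), 0] := by
    subst hv hvp; ext i; fin_cases i <;> simp [PT]
  have hPμ := hPT μ 0
  have hPv := hPT 1 0
  have hPvp := hPT 0 1
  have hP₁ := hPT (ω3 t * deriv φ t) (-deriv ω3 t)
  have hP₂ := hPT (deriv ω3 t) (ω3 t ^ 2)
  rw [add_comm] at hP₂
  simp only [neg_smul, zero_smul, one_smul, add_zero, zero_add, ← sub_eq_add_neg]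
    at hPμ hPv hPvp hP₁
  simp only [hPμ, hPv, hPvp, hP₁, hP₂]
  obtain ⟨hv₁, hw₁, he₁⟩ := hframe (α t) 0 (ω3 t)
  obtain ⟨hv₂, hw₂, -⟩ := hframe (deriv α t) (α t * deriv φ t) (deriv ω3 t)
  rw [← hωt] at hv₁ hw₁ he₁
  rw [hω'_eq] at hv₂ hw₂
  simp only [map_smul, map_sub, hv₁, hw₁, he₁, hv₂, hw₂, map_zero]
  generalize (![Real.cos (φ t), Real.sin (φ t), 0] : Fin 3 → ℝ) = V
  generalize (![-Real.sin (φ t), Real.cos (φ t), 0] : Fin 3 → ℝ) = W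
  generalize (![0, 0, 1] : Fin 3 → ℝ) = E
  simp only [mulVec_add, mulVec_sub, mulVec_smul, zero_smul, add_zero, sub_zero,
    zero_sub, mulVec_neg]
  generalize hy : μ • (R t *ᵥ V) = y
  generalize R t *ᵥ V = V' at *
  generalize R t *ᵥ W = W' at *
  generalize R t *ᵥ E = E' at *
  simp only [map_add, map_sub, map_neg, map_smul, _root_.add_apply,
    _root_.sub_apply,
    _root_.smul_apply, Complex.real_smul]
  rw [hsymm y V' W', hsymm y E' W']
  have hαC : (α t : ℂ) ≠ 0 := by exact_mod_cast hαt
  push_cast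
  field_simp
  ring

end
end

section
/- Let R ∈ C⁴(ℝ;SO(3)) with angular velocity ω ∈ C³(ℝ;ℝ³) having cylindrical decomposition ω = (αv, ω₃), v⊥ = (−v₂,v₁). Then for each fixed s ∈ ℝ, as t → s: (1/(t−s)) P(e₃ × (R(s)ᵀR(t)e₃)) = a₀(s) + a₁(s)(t−s) + o(t−s) and (1/(s−t)) P(e₃ × (R(t)ᵀR(s)e₃)) = b₀(s) + b₁(s)(t−s) + o(t−s), with a₀ = αv = b₀, 2a₁ = ω₃αv⊥ + (αv)′, and 2b₁ = −ω₃αv⊥ + (αv)′. -/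
open MeasureTheory Matrix Asymptotics Filter Topology

noncomputable section

attribute [local instance] Matrix.normedAddCommGroup Matrix.normedSpace

/-- Second-order Taylor expansion at a zero of `g`, divided by the increment. -/
lemma isLittleO_inv_smul_sub_of_hasDerivAt {E : Type*} [NormedAddCommGroup E] [NormedSpace ℝ E]
    {g g' : ℝ → E} {s : ℝ} {c : E} (hg : ∀ t, HasDerivAt g (g' t) t) (hg' : HasDerivAt g' c s)
    (h0 : g s = 0) :
    (fun t => (t - s)⁻¹ • g t - (g' s + (t - s) • ((2 : ℝ)⁻¹ • c)))
      =o[𝓝[≠] s] fun t => t - s := by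
  set h : ℝ → E := fun t => g t - (t - s) • g' s - ((2 : ℝ)⁻¹ * (t - s) ^ 2) • c with hh
  have hd : ∀ t, HasDerivAt h (g' t - g' s - (t - s) • c) t := by
    intro t
    have h1 : HasDerivAt (fun t : ℝ => t - s) 1 t := (hasDerivAt_id t).sub_const s
    have h2 : HasDerivAt (fun t : ℝ => (2 : ℝ)⁻¹ * (t - s) ^ 2) (t - s) t := by
      refine ((h1.fun_pow 2).const_mul (2 : ℝ)⁻¹).congr_deriv ?_
      simp
    have h3 := ((hg t).sub (h1.smul_const (g' s))).sub (h2.smul_const c)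
    rw [one_smul] at h3
    exact h3
  have hs : h s = 0 := by simp [hh, h0]
  rw [isLittleO_iff]
  intro ε hε
  have hlo := (isLittleO_iff.1 (hasDerivAt_iff_isLittleO.1 hg')) hε
  obtain ⟨δ, hδ, hball⟩ := Metric.eventually_nhds_iff_ball.1 hlo
  filter_upwards [nhdsWithin_le_nhds (Metric.ball_mem_nhds s hδ), self_mem_nhdsWithin]
    with t ht hne
  have hts : t - s ≠ 0 := sub_ne_zero.2 hne
  have hbound : ‖h t - h s‖ ≤ ε * ‖t - s‖ * ‖t - s‖ := by
    refine (convex_closedBall s ‖t - s‖).norm_image_sub_le_of_norm_hasDerivWithin_le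
      (f := h) (f' := fun x => g' x - g' s - (x - s) • c)
      (fun x _ => (hd x).hasDerivWithinAt) (fun x hx => ?_) (by simp) (by simp [dist_eq_norm])
    rw [Metric.mem_closedBall, dist_eq_norm] at hx
    refine (hball x ?_).trans (by gcongr)
    rw [Metric.mem_ball, dist_eq_norm] at ht ⊢
    exact hx.trans_lt ht
  rw [hs, sub_zero] at hbound
  have heq : (t - s)⁻¹ • g t - (g' s + (t - s) • ((2 : ℝ)⁻¹ • c)) = (t - s)⁻¹ • h t := by
    simp only [hh, smul_sub, smul_smul]
    rw [inv_mul_cancel₀ hts, one_smul,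
      show (t - s)⁻¹ * ((2 : ℝ)⁻¹ * (t - s) ^ 2) = (t - s) * 2⁻¹ by field_simp]
    abel
  rw [heq, norm_smul, norm_inv, inv_mul_le_iff₀ (norm_pos_iff.2 hts)]
  linarith

/-- The cross product with `e₃`, projected to the plane, is a rotation by a right angle. -/
lemma P2_crossProduct_e3 (x : Fin 3 → ℝ) : P2 (crossProduct e3 x) = ![-x 1, x 0] := by
  simp [P2, e3, cross_apply]

lemma mulVec_e3 (A : Matrix (Fin 3) (Fin 3) ℝ) (i : Fin 3) : (A *ᵥ e3) i = A i 2 := by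
  simp [mulVec, dotProduct, e3, Fin.sum_univ_three]

/-- The derivative of a curve of rotations, in terms of its angular velocity. -/
lemma deriv_eq_mul_of_angularVelocity {A A' : Matrix (Fin 3) (Fin 3) ℝ} (hA : SO3 A)
    {w : Fin 3 → ℝ} (hw : ∀ x, (Aᵀ * A') *ᵥ x = crossProduct w x) :
    A' = A * !![0, -w 2, w 1; w 2, 0, -w 0; -w 1, w 0, 0] := by
  have h : Aᵀ * A' = !![0, -w 2, w 1; w 2, 0, -w 0; -w 1, w 0, 0] := by
    ext i j
    have := congrFun (hw (Pi.single j 1)) i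
    rw [mulVec_single_one, col_apply] at this
    rw [this]
    fin_cases i <;> fin_cases j <;> simp [cross_apply]
  rw [← h, ← Matrix.mul_assoc, mul_eq_one_comm.1 hA.1, Matrix.one_mul]

/-- First-order Taylor expansion of the common-line directions. -/
theorem common_line_first_order_taylor
    (R : ℝ → Matrix (Fin 3) (Fin 3) ℝ) (hR : ContDiff ℝ 4 R) (hRso : ∀ t, SO3 (R t))
    (ω : ℝ → Fin 3 → ℝ) (hω : ContDiff ℝ 3 ω)
    (hang : ∀ t x, ((R t)ᵀ * deriv R t) *ᵥ x = crossProduct (ω t) x)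
    (α ω3 : ℝ → ℝ) (v : ℝ → Fin 2 → ℝ)
    (hα : ContDiff ℝ 3 α) (hv : ContDiff ℝ 3 v) (hω3 : ContDiff ℝ 3 ω3)
    (hαnn : ∀ t, 0 ≤ α t) (hvS : ∀ t, (v t 0) ^ 2 + (v t 1) ^ 2 = 1)
    (hcyl : ∀ t, ω t = ![α t * v t 0, α t * v t 1, ω3 t])
    (s : ℝ) :
    ((fun t => (t - s)⁻¹ • P2 (crossProduct e3 (((R s)ᵀ * R t) *ᵥ e3))
        - (α s • v s
          + (t - s) • ((2 : ℝ)⁻¹ • ((ω3 s * α s) • ![-(v s 1), v s 0]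
              + deriv (fun τ => α τ • v τ) s))))
      =o[𝓝[≠] s] fun t => t - s) ∧
    ((fun t => (s - t)⁻¹ • P2 (crossProduct e3 (((R t)ᵀ * R s) *ᵥ e3))
        - (α s • v s
          + (t - s) • ((2 : ℝ)⁻¹ • (-((ω3 s * α s) • ![-(v s 1), v s 0])
              + deriv (fun τ => α τ • v τ) s))))
      =o[𝓝[≠] s] fun t => t - s) := by
  set M : ℝ → Matrix (Fin 3) (Fin 3) ℝ := fun t => (R s)ᵀ * R t with hM
  have hMs : M s = 1 := (hRso s).1
  have hentry : ∀ t i j, HasDerivAt (fun τ => M τ i j)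
      ((M t * !![0, -ω t 2, ω t 1; ω t 2, 0, -ω t 0; -ω t 1, ω t 0, 0]) i j) t := by
    intro t i j
    have hRt : HasDerivAt R (deriv R t) t := (hR.differentiable (by norm_num) t).hasDerivAt
    have hRe : ∀ k, HasDerivAt (fun τ => R τ k j) (deriv R t k j) t := fun k =>
      hasDerivAt_pi.1 (hasDerivAt_pi.1 hRt k) j
    rw [hM, Matrix.mul_assoc, ← deriv_eq_mul_of_angularVelocity (hRso t) (hang t)]
    simp only [Matrix.mul_apply]
    exact HasDerivAt.fun_sum fun k _ => (hRe k).const_mul _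
  have hωd : ∀ i, HasDerivAt (fun τ => ω τ i) (deriv ω s i) s := fun i =>
    hasDerivAt_pi.1 (hω.differentiable (by norm_num) s).hasDerivAt i
  have hω0 : ∀ t, ω t 0 = α t * v t 0 := fun t => by simp [hcyl t]
  have hω1 : ∀ t, ω t 1 = α t * v t 1 := fun t => by simp [hcyl t]
  have hω2 : ∀ t, ω t 2 = ω3 t := fun t => by simp [hcyl t]
  have hαv : deriv (fun τ => α τ • v τ) s = ![deriv ω s 0, deriv ω s 1] := by
    refine HasDerivAt.deriv (hasDerivAt_pi.2 fun i => ?_)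
    fin_cases i
    · simpa [hω0] using hωd 0
    · simpa [hω1] using hωd 1
  have ha : α s • v s = ![ω s 0, ω s 1] := by
    ext i
    fin_cases i <;> simp [hω0, hω1]
  have hperp : (ω3 s * α s) • ![-(v s 1), v s 0] = ![-(ω s 2 * ω s 1), ω s 2 * ω s 0] := by
    ext i
    fin_cases i <;> simp [hω0, hω1, hω2, mul_assoc]
  have hM_eq : ∀ t, (R s)ᵀ * R t = M t := fun _ => rfl
  have hN : ∀ t, (R t)ᵀ * R s = (M t)ᵀ := fun t => by simp [hM]
  have hcol0 : ∀ t i, HasDerivAt (fun τ => M τ i 0) (M t i 1 * ω t 2 - M t i 2 * ω t 1) t :=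
    fun t i => (hentry t i 0).congr_deriv (by
      simp [Matrix.mul_apply, Fin.sum_univ_three, sub_eq_add_neg])
  have hcol1 : ∀ t i, HasDerivAt (fun τ => M τ i 1) (M t i 2 * ω t 0 - M t i 0 * ω t 2) t :=
    fun t i => (hentry t i 1).congr_deriv (by
      simp [Matrix.mul_apply, Fin.sum_univ_three, sub_eq_add_neg, add_comm])
  have hcol2 : ∀ t i, HasDerivAt (fun τ => M τ i 2) (M t i 0 * ω t 1 - M t i 1 * ω t 0) t :=
    fun t i => (hentry t i 2).congr_deriv (by
      simp [Matrix.mul_apply, Fin.sum_univ_three, sub_eq_add_neg])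
  simp only [P2_crossProduct_e3, mulVec_e3, hM_eq, hN, hαv, ha, hperp, transpose_apply]
  constructor
  · have h1 : ∀ t, HasDerivAt (fun τ => ![-M τ 1 2, M τ 0 2])
        ![-(M t 1 0 * ω t 1 - M t 1 1 * ω t 0), M t 0 0 * ω t 1 - M t 0 1 * ω t 0] t := by
      refine fun t => hasDerivAt_pi.2 fun i => ?_
      fin_cases i
      · exact (hcol2 t 1).fun_neg
      · exact hcol2 t 0
    have h2 : HasDerivAt
        (fun t => ![-(M t 1 0 * ω t 1 - M t 1 1 * ω t 0), M t 0 0 * ω t 1 - M t 0 1 * ω t 0])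
        (![-(ω s 2 * ω s 1), ω s 2 * ω s 0] + ![deriv ω s 0, deriv ω s 1]) s := by
      refine hasDerivAt_pi.2 fun i => ?_
      fin_cases i
      · refine (((hcol0 s 1).fun_mul (hωd 1)).fun_sub
          ((hcol1 s 1).fun_mul (hωd 0))).fun_neg.congr_deriv ?_
        simp [hMs]
        ring
      · refine (((hcol0 s 0).fun_mul (hωd 1)).fun_sub
          ((hcol1 s 0).fun_mul (hωd 0))).congr_deriv ?_
        simp [hMs]
        ring
    refine (isLittleO_inv_smul_sub_of_hasDerivAt h1 h2 (by simp [hMs])).congr_left fun t => ?_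
    simp [hMs]
  · have h1 : ∀ t, HasDerivAt (fun τ => ![M τ 2 1, -M τ 2 0])
        ![M t 2 2 * ω t 0 - M t 2 0 * ω t 2, -(M t 2 1 * ω t 2 - M t 2 2 * ω t 1)] t := by
      refine fun t => hasDerivAt_pi.2 fun i => ?_
      fin_cases i
      · exact hcol1 t 2
      · exact (hcol0 t 2).fun_neg
    have h2 : HasDerivAt
        (fun t => ![M t 2 2 * ω t 0 - M t 2 0 * ω t 2, -(M t 2 1 * ω t 2 - M t 2 2 * ω t 1)])
        (-![-(ω s 2 * ω s 1), ω s 2 * ω s 0] + ![deriv ω s 0, deriv ω s 1]) s := by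
      refine hasDerivAt_pi.2 fun i => ?_
      fin_cases i
      · refine (((hcol2 s 2).fun_mul (hωd 0)).fun_sub
          ((hcol0 s 2).fun_mul (hωd 2))).congr_deriv ?_
        simp [hMs]
        ring
      · refine (((hcol1 s 2).fun_mul (hωd 2)).fun_sub
          ((hcol2 s 2).fun_mul (hωd 1))).fun_neg.congr_deriv ?_
        simp [hMs]
        ring
    refine (isLittleO_inv_smul_sub_of_hasDerivAt h1 h2 (by simp [hMs])).congr_left fun t => ?_
    have hneg : (s - t)⁻¹ = -(t - s)⁻¹ := by rw [← inv_neg, neg_sub]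
    simp [hMs, hneg]

end
end

section
/- Let R ∈ C⁴(ℝ;SO(3)) with angular velocity ω ∈ C³(ℝ;ℝ³) having cylindrical decomposition ω = (αv, ω₃), v⊥ = (−v₂,v₁). Then for each fixed s ∈ ℝ, as t → s: (1/(t−s)) P(e₃ × (R(s)ᵀR(t)e₃)) = Σ_{j=0}^{3} aⱼ(s)(t−s)ʲ + o((t−s)³) and (1/(s−t)) P(e₃ × (R(t)ᵀR(s)e₃)) = Σ_{j=0}^{3} bⱼ(s)(t−s)ʲ + o((t−s)³), where a₀ = αv, 2a₁ = ω₃αv⊥ + (αv)′, 6a₂ = −(α²+ω₃²)αv + 2ω₃(αv⊥)′ + ω₃′αv⊥ + (αv)″, 24a₃ = −(α²+ω₃²)ω₃αv⊥ + 2ω₃ω₃′αv − 2ω₃²(αv)′ − 5(αα′+ω₃ω₃′)αv + 3ω₃(αv⊥)″ − (α²+ω₃²)(αv)′ + 3ω₃′(αv⊥)′ + ω₃″αv⊥ + (αv)‴, b₀ = αv, 2b₁ = −ω₃αv⊥ + (αv)′, 6b₂ = −(α²+ω₃²)αv − ω₃(αv⊥)′ − 2ω₃′αv⊥ + (αv)″,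 and 24b₃ = (α²+ω₃²)ω₃αv⊥ − 2ω₃ω₃′αv + 2ω₃²(αv)′ − 3(αα′+ω₃ω₃′)αv − ω₃(αv⊥)″ − 3(α²+ω₃²)(αv)′ − 3ω₃′(αv⊥)′ − 3ω₃″αv⊥ + (αv)‴ (all coefficients evaluated at s). -/
open MeasureTheory Matrix Asymptotics Filter Topology

noncomputable section

attribute [local instance] Matrix.normedAddCommGroup Matrix.normedSpace

theorem HasDerivAt.crossProduct {f g : ℝ → Fin 3 → ℝ} {f' g' : Fin 3 → ℝ} {t : ℝ}
    (hf : HasDerivAt f f' t) (hg : HasDerivAt g g' t) :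
    HasDerivAt (fun τ => f τ ⨯₃ g τ) (f' ⨯₃ g t + f t ⨯₃ g') t := by
  rw [hasDerivAt_pi] at hf hg ⊢
  have key : ∀ i j k l, HasDerivAt (fun τ => f τ i * g τ j - f τ k * g τ l)
      (f' i * g t j + f t i * g' j - (f' k * g t l + f t k * g' l)) t := fun i j k l =>
    ((hf i).mul (hg j)).sub ((hf k).mul (hg l))
  intro i
  fin_cases i
  · exact HasDerivAt.congr_deriv (key 1 2 2 1) (by simp [cross_apply]; ring)
  · exact HasDerivAt.congr_deriv (key 2 0 0 2) (by simp [cross_apply]; ring)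
  · exact HasDerivAt.congr_deriv (key 0 1 1 0) (by simp [cross_apply]; ring)

/-- Fourth-order Taylor expansion of a solution of `m' = m × ω`. -/
theorem taylor_four_of_deriv_eq_crossProduct {m ω ω' ω'' ω''' : ℝ → Fin 3 → ℝ}
    (hm : ContDiff ℝ 4 m) (hmω : ∀ t, HasDerivAt m (m t ⨯₃ ω t) t)
    (h1 : ∀ t, HasDerivAt ω (ω' t) t) (h2 : ∀ t, HasDerivAt ω' (ω'' t) t)
    (h3 : ∀ t, HasDerivAt ω'' (ω''' t) t) (s : ℝ) (d1 d2 d3 d4 : Fin 3 → ℝ)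
    (hd1 : d1 = m s ⨯₃ ω s) (hd2 : d2 = d1 ⨯₃ ω s + m s ⨯₃ ω' s)
    (hd3 : d3 = d2 ⨯₃ ω s + (2 : ℝ) • d1 ⨯₃ ω' s + m s ⨯₃ ω'' s)
    (hd4 : d4 = d3 ⨯₃ ω s + (3 : ℝ) • d2 ⨯₃ ω' s + (3 : ℝ) • d1 ⨯₃ ω'' s + m s ⨯₃ ω''' s)
    (i : Fin 3) :
    (fun t => m t i - (m s i + (t - s) * (d1 i + (t - s) * (d2 i / 2) + (t - s) ^ 2 * (d3 i / 6)
      + (t - s) ^ 3 * (d4 i / 24)))) =o[𝓝 s] fun t => (t - s) ^ 4 := by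
  have e1 : iteratedDeriv 1 m = fun t => m t ⨯₃ ω t := by
    rw [iteratedDeriv_one]; exact funext fun t => (hmω t).deriv
  have g1 : ∀ t, HasDerivAt (iteratedDeriv 1 m)
      (iteratedDeriv 1 m t ⨯₃ ω t + m t ⨯₃ ω' t) t := fun t => by
    rw [e1]; exact (hmω t).crossProduct (h1 t)
  have e2 : iteratedDeriv 2 m = fun t => iteratedDeriv 1 m t ⨯₃ ω t + m t ⨯₃ ω' t := by
    rw [iteratedDeriv_succ]; exact funext fun t => (g1 t).deriv
  have hm' : ∀ t, HasDerivAt m (iteratedDeriv 1 m t) t := fun t => by rw [e1]; exact hmω t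
  have hm1 : ∀ t, HasDerivAt (iteratedDeriv 1 m) (iteratedDeriv 2 m t) t := fun t => by
    rw [e2]; exact g1 t
  have g2 : ∀ t, HasDerivAt (iteratedDeriv 2 m) (iteratedDeriv 2 m t ⨯₃ ω t
      + (2 : ℝ) • iteratedDeriv 1 m t ⨯₃ ω' t + m t ⨯₃ ω'' t) t := fun t => by
    have := ((hm1 t).crossProduct (h1 t)).add ((hm' t).crossProduct (h2 t))
    exact (this.congr_deriv (by module)).congr_of_eventuallyEq
      (Eventually.of_forall fun τ => congrFun e2 τ)
  have e3 : iteratedDeriv 3 m = fun t => iteratedDeriv 2 m t ⨯₃ ω t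
      + (2 : ℝ) • iteratedDeriv 1 m t ⨯₃ ω' t + m t ⨯₃ ω'' t := by
    rw [iteratedDeriv_succ]; exact funext fun t => (g2 t).deriv
  have hm2 : ∀ t, HasDerivAt (iteratedDeriv 2 m) (iteratedDeriv 3 m t) t := fun t => by
    rw [e3]; exact g2 t
  have e4 : iteratedDeriv 4 m = fun t => iteratedDeriv 3 m t ⨯₃ ω t
      + (3 : ℝ) • iteratedDeriv 2 m t ⨯₃ ω' t + (3 : ℝ) • iteratedDeriv 1 m t ⨯₃ ω'' t
      + m t ⨯₃ ω''' t := by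
    rw [iteratedDeriv_succ]
    funext t
    have := (((hm2 t).crossProduct (h1 t)).add
      (((hm1 t).crossProduct (h2 t)).const_smul (2 : ℝ))).add ((hm' t).crossProduct (h3 t))
    nth_rw 1 [e3]
    refine this.deriv.trans ?_
    module
  have E1 : iteratedDeriv 1 m s = d1 := by rw [e1, hd1]
  have E2 : iteratedDeriv 2 m s = d2 := by rw [e2, hd2, ← E1]
  have E3 : iteratedDeriv 3 m s = d3 := by rw [e3, hd3, ← E2, ← E1]
  have E4 : iteratedDeriv 4 m s = d4 := by rw [e4, hd4, ← E3, ← E2, ← E1]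
  have T := taylor_isLittleO_univ (x₀ := s) (n := 4) (f := m) (by exact_mod_cast hm)
  rw [isLittleO_pi] at T
  refine (T i).congr_left fun t => ?_
  simp only [taylorWithinEval_succ, taylor_within_zero_eval, iteratedDerivWithin_univ]
  norm_num [E1, E2, E3, E4, Nat.factorial]
  ring

/-- Dividing a fourth-order expansion without constant term by `t - s`, up to a factor `ε`. -/
theorem isLittleO_inv_mul_sub {g h : ℝ → ℝ} {s c0 c1 c2 c3 d0 d1 d2 d3 e : ℝ}
    (hg : (fun t => g t
      - (e + (t - s) * (d0 + (t - s) * d1 + (t - s) ^ 2 * d2 + (t - s) ^ 3 * d3)))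
        =o[𝓝 s] fun t => (t - s) ^ 4)
    (ε : ℝ) (he : e = 0) (hh : ∀ t, h t = (t - s)⁻¹ * (ε * g t))
    (h0 : c0 = ε * d0) (h1 : c1 = ε * d1) (h2 : c2 = ε * d2) (h3 : c3 = ε * d3) :
    (fun t => h t - (c0 + (t - s) * c1 + (t - s) ^ 2 * c2 + (t - s) ^ 3 * c3))
      =o[𝓝[≠] s] fun t => (t - s) ^ 3 := by
  subst he h0 h1 h2 h3
  refine ((isBigO_refl (fun t => (t - s)⁻¹) (𝓝[≠] s)).mul_isLittleO
    ((hg.const_mul_left ε).mono nhdsWithin_le_nhds)).congr' ?_ ?_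
  · filter_upwards [self_mem_nhdsWithin] with t ht
    have : t - s ≠ 0 := sub_ne_zero.2 ht
    rw [hh]
    field_simp
    ring
  · filter_upwards [self_mem_nhdsWithin] with t ht
    have : t - s ≠ 0 := sub_ne_zero.2 ht
    field_simp

theorem hasDerivAt_vec2 {f g : ℝ → ℝ} {f' g' t : ℝ} (hf : HasDerivAt f f' t)
    (hg : HasDerivAt g g' t) : HasDerivAt (fun τ => ![f τ, g τ]) ![f', g'] t := by
  rw [hasDerivAt_pi]
  intro i
  fin_cases i
  · exact hf
  · exact hg

theorem hasDerivAt_vec3 {f g h : ℝ → ℝ} {f' g' h' t : ℝ} (hf : HasDerivAt f f' t)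
    (hg : HasDerivAt g g' t) (hh : HasDerivAt h h' t) :
    HasDerivAt (fun τ => ![f τ, g τ, h τ]) ![f', g', h'] t := by
  rw [hasDerivAt_pi]
  intro i
  fin_cases i
  · exact hf
  · exact hg
  · exact hh

theorem iteratedDeriv_vec2 {n : ℕ} {f g : ℝ → ℝ} (hf : ContDiff ℝ n f) (hg : ContDiff ℝ n g) :
    iteratedDeriv n (fun τ => ![f τ, g τ])
      = fun τ => ![iteratedDeriv n f τ, iteratedDeriv n g τ] := by
  induction n with
  | zero => simp
  | succ n ih =>
    rw [iteratedDeriv_succ, ih (hf.of_le (by simp)) (hg.of_le (by simp))]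
    funext t
    simp only [iteratedDeriv_succ]
    exact (hasDerivAt_vec2 (hf.differentiable_iteratedDeriv n (by norm_cast; simp) t).hasDerivAt
      (hg.differentiable_iteratedDeriv n (by norm_cast; simp) t).hasDerivAt).deriv

theorem ContDiff.hasDerivAt_iteratedDeriv {n k : ℕ} {f : ℝ → ℝ} (hf : ContDiff ℝ n f)
    (hk : k < n) (t : ℝ) :
    HasDerivAt (iteratedDeriv k f) (iteratedDeriv (k + 1) f t) t := by
  rw [iteratedDeriv_succ]
  exact (hf.differentiable_iteratedDeriv k (by exact_mod_cast hk) t).hasDerivAt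

/-- The rows of `R(s)ᵀ R(t)` solve `m' = m × ω`. -/
theorem hasDerivAt_row_transpose_mul {R : ℝ → Matrix (Fin 3) (Fin 3) ℝ}
    (hR : ContDiff ℝ 4 R) (hRso : ∀ t, SO3 (R t)) {ω : ℝ → Fin 3 → ℝ}
    (hang : ∀ t x, ((R t)ᵀ * deriv R t) *ᵥ x = ω t ⨯₃ x) (A : Matrix (Fin 3) (Fin 3) ℝ)
    (i : Fin 3) (t : ℝ) :
    HasDerivAt (fun τ => (A * R τ) i) ((A * R t) i ⨯₃ ω t) t := by
  have hd : HasDerivAt R (deriv R t) t := (hR.differentiable (by norm_num) t).hasDerivAt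
  have hd' : ∀ k j, HasDerivAt (fun τ => R τ k j) (deriv R t k j) t := fun k j =>
    hasDerivAt_pi.1 (hasDerivAt_pi.1 hd k) j
  have hA : A * deriv R t = A * R t * ((R t)ᵀ * deriv R t) := by
    rw [Matrix.mul_assoc, ← Matrix.mul_assoc (R t), mul_eq_one_comm.1 (hRso t).1, Matrix.one_mul]
  have hrow : (A * R t) i ⨯₃ ω t = (A * deriv R t) i := by
    have hΩ : ∀ k j, ((R t)ᵀ * deriv R t) k j = (ω t ⨯₃ Pi.single j 1) k := fun k j => by
      rw [← hang]; simp
    funext j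
    rw [hA, Matrix.mul_apply, Fin.sum_univ_three]
    simp only [hΩ]
    fin_cases j <;> simp [cross_apply] <;> ring
  rw [hrow, hasDerivAt_pi]
  intro j
  simp only [Matrix.mul_apply]
  exact HasDerivAt.fun_sum fun k _ => (hd' k j).const_mul (A i k)

theorem contDiff_row_mul {n : WithTop ℕ∞} {R : ℝ → Matrix (Fin 3) (Fin 3) ℝ}
    (hR : ContDiff ℝ n R) (A : Matrix (Fin 3) (Fin 3) ℝ) (i : Fin 3) :
    ContDiff ℝ n (fun τ => (A * R τ) i) := by
  have hR' : ∀ k j, ContDiff ℝ n (fun τ => R τ k j) := fun k j =>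
    contDiff_pi.1 (contDiff_pi.1 hR k) j
  rw [contDiff_pi]
  intro j
  simp only [Matrix.mul_apply]
  exact ContDiff.sum fun k _ => contDiff_const.mul (hR' k j)

/-- Third-order Taylor expansion of the common-line directions, with all the
coefficients of the paper. -/
theorem common_line_third_order_taylor
    (R : ℝ → Matrix (Fin 3) (Fin 3) ℝ) (hR : ContDiff ℝ 4 R) (hRso : ∀ t, SO3 (R t))
    (ω : ℝ → Fin 3 → ℝ) (hω : ContDiff ℝ 3 ω)
    (hang : ∀ t x, ((R t)ᵀ * deriv R t) *ᵥ x = crossProduct (ω t) x)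
    (α ω3 : ℝ → ℝ) (v : ℝ → Fin 2 → ℝ)
    (hα : ContDiff ℝ 3 α) (hv : ContDiff ℝ 3 v) (hω3 : ContDiff ℝ 3 ω3)
    (hαnn : ∀ t, 0 ≤ α t) (hvS : ∀ t, (v t 0) ^ 2 + (v t 1) ^ 2 = 1)
    (hcyl : ∀ t, ω t = ![α t * v t 0, α t * v t 1, ω3 t])
    (vp : ℝ → Fin 2 → ℝ) (hvp : ∀ τ, vp τ = ![-(v τ 1), v τ 0])
    -- the functions `αv` and `αv⊥`
    (w z : ℝ → Fin 2 → ℝ) (hw : ∀ τ, w τ = α τ • v τ) (hz : ∀ τ, z τ = α τ • vp τ)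
    (s : ℝ)
    (a0 a1 a2 a3 b0 b1 b2 b3 : Fin 2 → ℝ)
    (ha0 : a0 = α s • v s)
    (ha1 : a1 = (2 : ℝ)⁻¹ • ((ω3 s * α s) • vp s + deriv w s))
    (ha2 : a2 = (6 : ℝ)⁻¹ • ((-((α s ^ 2 + ω3 s ^ 2) * α s)) • v s
      + (2 * ω3 s) • deriv z s + (deriv ω3 s * α s) • vp s + iteratedDeriv 2 w s))
    (ha3 : a3 = (24 : ℝ)⁻¹ • ((-((α s ^ 2 + ω3 s ^ 2) * ω3 s * α s)) • vp s
      + (2 * ω3 s * deriv ω3 s * α s) • v s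
      - (2 * ω3 s ^ 2) • deriv w s
      - (5 * (α s * deriv α s + ω3 s * deriv ω3 s) * α s) • v s
      + (3 * ω3 s) • iteratedDeriv 2 z s
      - (α s ^ 2 + ω3 s ^ 2) • deriv w s
      + (3 * deriv ω3 s) • deriv z s
      + (iteratedDeriv 2 ω3 s * α s) • vp s
      + iteratedDeriv 3 w s))
    (hb0 : b0 = α s • v s)
    (hb1 : b1 = (2 : ℝ)⁻¹ • (-((ω3 s * α s) • vp s) + deriv w s))
    (hb2 : b2 = (6 : ℝ)⁻¹ • ((-((α s ^ 2 + ω3 s ^ 2) * α s)) • v s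
      - ω3 s • deriv z s - (2 * deriv ω3 s * α s) • vp s + iteratedDeriv 2 w s))
    (hb3 : b3 = (24 : ℝ)⁻¹ • (((α s ^ 2 + ω3 s ^ 2) * ω3 s * α s) • vp s
      - (2 * ω3 s * deriv ω3 s * α s) • v s
      + (2 * ω3 s ^ 2) • deriv w s
      - (3 * (α s * deriv α s + ω3 s * deriv ω3 s) * α s) • v s
      - ω3 s • iteratedDeriv 2 z s
      - (3 * (α s ^ 2 + ω3 s ^ 2)) • deriv w s
      - (3 * deriv ω3 s) • deriv z s
      - (3 * iteratedDeriv 2 ω3 s * α s) • vp s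
      + iteratedDeriv 3 w s)) :
    ((fun t => (t - s)⁻¹ • P2 (crossProduct e3 (((R s)ᵀ * R t) *ᵥ e3))
        - (a0 + (t - s) • a1 + ((t - s) ^ 2) • a2 + ((t - s) ^ 3) • a3))
      =o[𝓝[≠] s] fun t => (t - s) ^ 3) ∧
    ((fun t => (s - t)⁻¹ • P2 (crossProduct e3 (((R t)ᵀ * R s) *ᵥ e3))
        - (b0 + (t - s) • b1 + ((t - s) ^ 2) • b2 + ((t - s) ^ 3) • b3))
      =o[𝓝[≠] s] fun t => (t - s) ^ 3) := by
  set p : ℝ → ℝ := fun t => α t * v t 0 with hp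
  set q : ℝ → ℝ := fun t => α t * v t 1 with hq
  have cp : ContDiff ℝ (3 : ℕ) p := by exact_mod_cast hα.mul (contDiff_pi.1 hv 0)
  have cq : ContDiff ℝ (3 : ℕ) q := by exact_mod_cast hα.mul (contDiff_pi.1 hv 1)
  have cr : ContDiff ℝ (3 : ℕ) ω3 := by exact_mod_cast hω3
  have hw' : w = fun t => ![p t, q t] := by
    funext t i; rw [hw]; fin_cases i <;> simp [hp, hq]
  have hz' : z = fun t => ![(-q) t, p t] := by
    funext t i; rw [hz, hvp]; fin_cases i <;> simp [hp, hq]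
  have hω' : ω = fun t => ![p t, q t, ω3 t] := funext hcyl
  have dω : ∀ k < 3, ∀ t, HasDerivAt
      (fun τ => ![iteratedDeriv k p τ, iteratedDeriv k q τ, iteratedDeriv k ω3 τ])
      ![iteratedDeriv (k + 1) p t, iteratedDeriv (k + 1) q t, iteratedDeriv (k + 1) ω3 t] t :=
    fun k hk t => hasDerivAt_vec3 (cp.hasDerivAt_iteratedDeriv hk t)
      (cq.hasDerivAt_iteratedDeriv hk t) (cr.hasDerivAt_iteratedDeriv hk t)
  have Dw : ∀ k ≤ 3, iteratedDeriv k w s = ![iteratedDeriv k p s, iteratedDeriv k q s] :=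
    fun k hk => by
      rw [hw', iteratedDeriv_vec2 (cp.of_le (by exact_mod_cast hk))
        (cq.of_le (by exact_mod_cast hk))]
  have Dz : ∀ k ≤ 3, iteratedDeriv k z s = ![-iteratedDeriv k q s, iteratedDeriv k p s] :=
    fun k hk => by
      rw [hz', iteratedDeriv_vec2 (f := -q) (cq.neg.of_le (by exact_mod_cast hk))
        (cp.of_le (by exact_mod_cast hk))]
      simp only [iteratedDeriv_neg]
  have hsq : ∀ t, α t ^ 2 = p t ^ 2 + q t ^ 2 := fun t => by
    simp only [hp, hq]; linear_combination (-(α t ^ 2)) * hvS t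
  have hsq' : α s * deriv α s = p s * deriv p s + q s * deriv q s := by
    have dα := (hα.differentiable (by norm_num) s).hasDerivAt
    have dp := (cp.differentiable (by norm_num) s).hasDerivAt
    have dq := (cq.differentiable (by norm_num) s).hasDerivAt
    have h1 := dα.pow 2
    have h2 := (dp.pow 2).add (dq.pow 2)
    have h3 : α ^ 2 = p ^ 2 + q ^ 2 := funext hsq
    rw [h3] at h1
    have := h1.unique h2
    norm_num at this
    linarith
  have w1 : deriv w s = ![deriv p s, deriv q s] := by
    simpa [iteratedDeriv_one] using Dw 1 (by norm_num)
  have z1 : deriv z s = ![-deriv q s, deriv p s] := by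
    simpa [iteratedDeriv_one] using Dz 1 (by norm_num)
  have w2 := Dw 2 (by norm_num)
  have w3 := Dw 3 le_rfl
  have z2 := Dz 2 (by norm_num)
  have hp0 : p s = α s * v s 0 := rfl
  have hq0 : q s = α s * v s 1 := rfl
  have row : ∀ i, ((R s)ᵀ * R s) i = (1 : Matrix (Fin 3) (Fin 3) ℝ) i := fun i => by
    rw [(hRso s).1]
  have T := fun i => taylor_four_of_deriv_eq_crossProduct (contDiff_row_mul hR (R s)ᵀ i)
    (hasDerivAt_row_transpose_mul hR hRso hang (R s)ᵀ i)
    (fun t => by simpa [hω'] using dω 0 (by norm_num) t) (dω 1 (by norm_num))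
    (dω 2 (by norm_num)) s _ _ _ _ rfl rfl rfl rfl
  simp only [row] at T
  have T02 := T 0 2
  have T12 := T 1 2
  have T20 := T 2 0
  have T21 := T 2 1
  have P0 : ∀ x, P2 (e3 ⨯₃ x) 0 = -x 1 := fun x => by simp [P2, e3, cross_apply]
  have P1 : ∀ x, P2 (e3 ⨯₃ x) 1 = x 0 := fun x => by simp [P2, e3, cross_apply]
  have M3 : ∀ (A : Matrix (Fin 3) (Fin 3) ℝ) i, (A *ᵥ e3) i = A i 2 := fun A i => by
    simp [e3, Matrix.mulVec, dotProduct, Fin.sum_univ_three]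
  have tr : ∀ t i, ((R t)ᵀ * R s) i 2 = ((R s)ᵀ * R t) 2 i := fun t i => by
    simp only [Matrix.mul_apply, Matrix.transpose_apply, mul_comm]
  have inv : ∀ t, (s - t)⁻¹ = -(t - s)⁻¹ := fun t => by rw [← neg_sub, inv_neg]
  simp only [hω', cross_apply] at T02 T12 T20 T21
  rw [hsq s, w2, z1, hvp s] at ha2
  rw [hsq s, hsq', w1, w3, z1, z2, hvp s] at ha3
  rw [hsq s, w2, z1, hvp s] at hb2
  rw [hsq s, hsq', w1, w3, z1, z2, hvp s] at hb3
  rw [w1, hvp s] at ha1 hb1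
  constructor <;> rw [isLittleO_pi, Fin.forall_fin_two] <;> constructor
  · refine isLittleO_inv_mul_sub T12 (-1) (by simp) (fun t => by simp [P0, M3]) ?_ ?_ ?_ ?_ <;>
    simp [ha0, ha1, ha2, ha3, iteratedDeriv_one, hp0, hq0, vecHead, vecTail] <;> ring
  · refine isLittleO_inv_mul_sub T02 1 (by simp) (fun t => by simp [P1, M3]) ?_ ?_ ?_ ?_ <;>
    simp [ha0, ha1, ha2, ha3, iteratedDeriv_one, hp0, hq0, vecHead, vecTail] <;> ring
  · refine isLittleO_inv_mul_sub T21 1 (by simp) (fun t => by simp [P0, M3, tr, inv]) ?_ ?_ ?_ ?_ <;>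
    simp [hb0, hb1, hb2, hb3, iteratedDeriv_one, hp0, hq0, vecHead, vecTail] <;> ring
  · refine isLittleO_inv_mul_sub T20 (-1) (by simp) (fun t => by simp [P1, M3, tr, inv]) ?_ ?_ ?_ ?_ <;>
    simp [hb0, hb1, hb2, hb3, iteratedDeriv_one, hp0, hq0, vecHead, vecTail] <;> ring

end
end

section
/- Let u be an admissible attenuation coefficient with center C₃, let T ∈ C(ℝ;ℝ³), R ∈ C(ℝ;SO(3)), and let Σ = diag(1,1,−1). Define the reflected object û(x) = u(Σx), which has center ΣC₃, the reflected rotation Ř(t) = ΣR(t)Σ, and the reflected translation Ť(t) = ΣT(t). Then the attenuation projection data coincide: for all t ∈ ℝ and (x₁,x₂) ∈ ℝ², ∫_ℝ u(C₃ + R(t)(x − C₃ + T(t))) dx₃ = ∫_ℝ û(ΣC₃ + Ř(t)(x − ΣC₃ + Ť(t))) dx₃ (moreover Ř(t) ∈ SO(3) for all t). -/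
open MeasureTheory Matrix

noncomputable section

/-- The reflection `Σ = diag(1,1,−1)` in the `x₁x₂`-plane. -/
def Sig : Matrix (Fin 3) (Fin 3) ℝ := Matrix.diagonal ![1, 1, -1]

theorem Sig_mul_Sig : Sig * Sig = 1 := by
  ext i j
  fin_cases i <;> fin_cases j <;> simp [Sig]

theorem Sig_transpose : Sigᵀ = Sig := Matrix.diagonal_transpose _

theorem Sig_det : Sig.det = -1 := by
  simp [Sig, Matrix.det_diagonal, Fin.prod_univ_three]

theorem Sig_mulVec_Sig_mulVec (x : Fin 3 → ℝ) : Sig *ᵥ (Sig *ᵥ x) = x := by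
  rw [Matrix.mulVec_mulVec, Sig_mul_Sig, Matrix.one_mulVec]

theorem Sig_mulVec_vec (a b c : ℝ) : Sig *ᵥ ![a, b, c] = ![a, b, -c] := by
  ext i
  fin_cases i <;> simp [Sig, Matrix.mulVec_diagonal]

/-- The reflection `Sig` as a continuous linear equivalence. -/
def sigEquiv : (Fin 3 → ℝ) ≃L[ℝ] (Fin 3 → ℝ) :=
  (LinearEquiv.ofInvolutive (Matrix.toLin' Sig) fun x => by
    simp only [Matrix.toLin'_apply, Sig_mulVec_Sig_mulVec]).toContinuousLinearEquiv

theorem sigEquiv_apply (x : Fin 3 → ℝ) : sigEquiv x = Sig *ᵥ x := rfl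

theorem measurePreserving_sigEquiv : MeasurePreserving sigEquiv := by
  refine ⟨sigEquiv.continuous.measurable, ?_⟩
  have h := Real.map_matrix_volume_pi_eq_smul_volume_pi (M := Sig) (by simp [Sig_det])
  simp only [Sig_det, inv_neg, inv_one, abs_neg, abs_one, ENNReal.ofReal_one, one_smul] at h
  exact h

theorem integral_comp_Sig_mulVec {E : Type*} [NormedAddCommGroup E] [NormedSpace ℝ E]
    (f : (Fin 3 → ℝ) → E) : ∫ x, f (Sig *ᵥ x) = ∫ x, f x :=
  measurePreserving_sigEquiv.integral_comp sigEquiv.toHomeomorph.measurableEmbedding f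

/-- Reflecting a density reflects its first moment. -/
theorem integral_comp_Sig_mulVec_smul_id (u : (Fin 3 → ℝ) → ℝ) :
    ∫ x, u (Sig *ᵥ x) • x = Sig *ᵥ ∫ x, u x • x := by
  calc ∫ x, u (Sig *ᵥ x) • x = ∫ x, u (Sig *ᵥ x) • sigEquiv (Sig *ᵥ x) := by
        simp only [sigEquiv_apply, Sig_mulVec_Sig_mulVec]
    _ = ∫ x, u x • sigEquiv x := integral_comp_Sig_mulVec fun x => u x • sigEquiv x
    _ = ∫ x, sigEquiv (u x • x) := by simp only [map_smul]
    _ = Sig *ᵥ ∫ x, u x • x := sigEquiv.integral_comp_comm _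

theorem SO3.conj_Sig {A : Matrix (Fin 3) (Fin 3) ℝ} (hA : SO3 A) : SO3 (Sig * A * Sig) := by
  refine ⟨?_, by simp [Matrix.det_mul, Sig_det, hA.2]⟩
  calc (Sig * A * Sig)ᵀ * (Sig * A * Sig) = Sig * (Aᵀ * ((Sig * Sig) * A)) * Sig := by
        simp only [Matrix.transpose_mul, Sig_transpose, Matrix.mul_assoc]
    _ = 1 := by rw [Sig_mul_Sig, Matrix.one_mul, hA.1, Matrix.mul_one, Sig_mul_Sig]

theorem Sig_mulVec_reflected_motion (A : Matrix (Fin 3) (Fin 3) ℝ) (c x v : Fin 3 → ℝ) :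
    Sig *ᵥ (Sig *ᵥ c + (Sig * A * Sig) *ᵥ (x - Sig *ᵥ c + Sig *ᵥ v)) =
      c + A *ᵥ (Sig *ᵥ x - c + v) := by
  simp only [← Matrix.mulVec_mulVec, Matrix.mulVec_add, Matrix.mulVec_sub, Sig_mulVec_Sig_mulVec]

/-- The reflected object, moved by the reflected rigid motion, produces exactly the same
attenuation projection data; the reflected object has center `ΣC₃` and the reflected
rotation stays in SO(3). -/
theorem reflected_motion_same_projections
    (u : (Fin 3 → ℝ) → ℝ) (hu_cont : Continuous u) (hu_nonneg : ∀ x, 0 ≤ u x)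
    (hu_supp : IsCompact (tsupport u)) (hu_ne : (Function.support u).Nonempty)
    (C3 : Fin 3 → ℝ)
    (hC3 : C3 = (∫ x : Fin 3 → ℝ, u x)⁻¹ • ∫ x : Fin 3 → ℝ, u x • x)
    (T : ℝ → Fin 3 → ℝ) (hT : Continuous T)
    (R : ℝ → Matrix (Fin 3) (Fin 3) ℝ) (hR : Continuous R) (hRso : ∀ t, SO3 (R t))
    (uref : (Fin 3 → ℝ) → ℝ) (huref : ∀ x, uref x = u (Sig *ᵥ x))
    (Rref : ℝ → Matrix (Fin 3) (Fin 3) ℝ) (hRref : ∀ t, Rref t = Sig * R t * Sig)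
    (Tref : ℝ → Fin 3 → ℝ) (hTref : ∀ t, Tref t = Sig *ᵥ T t) :
    ((∫ x : Fin 3 → ℝ, uref x)⁻¹ • ∫ x : Fin 3 → ℝ, uref x • x) = Sig *ᵥ C3 ∧
    (∀ t, SO3 (Rref t)) ∧
    (∀ (t : ℝ) (p : Fin 2 → ℝ),
      (∫ x3 : ℝ, u (C3 + R t *ᵥ (![p 0, p 1, x3] - C3 + T t))) =
        ∫ x3 : ℝ, uref (Sig *ᵥ C3 + Rref t *ᵥ (![p 0, p 1, x3] - Sig *ᵥ C3 + Tref t))) := by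
  obtain rfl : uref = fun x => u (Sig *ᵥ x) := funext huref
  refine ⟨?_, fun t => hRref t ▸ (hRso t).conj_Sig, fun t p => ?_⟩
  · rw [integral_comp_Sig_mulVec, integral_comp_Sig_mulVec_smul_id, hC3, Matrix.mulVec_smul]
  · simp only [hRref, hTref, Sig_mulVec_reflected_motion, Sig_mulVec_vec]
    exact (integral_neg_eq_self
      (fun x3 : ℝ => u (C3 + R t *ᵥ (![p 0, p 1, x3] - C3 + T t))) volume).symm

end
end
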